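/- arXiv:2004.03832 — 2 statements merged into one kernel-verified Lean document; each statement's English description precedes it below -/
import Mathlib

section
/- (Energy estimates, Fourier formulation.) Let μ > 0 with μ ≠ 1/4 and let d ≥ 1. Then there exists C > 0, independent of t, t₀ and of the data, such that for all t ≥ t₀ ≥ 0 and all measurable g₀, g₁ : ℝ^d → ℂ with ‖g₀‖_{L²} + ‖|ξ|g₀‖_{L²} + ‖g₁‖_{L²} < ∞, the following hold: (a) ‖ |ξ| (E_0(t,t₀,·) g₀ + E_1(t,t₀,·) g₁) ‖_{L²} ≤ C (‖g₀‖_{L²} + ‖|ξ|g₀‖_{L²} + ‖g₁‖_{L²}); (b) ‖ Ė_0(t,t₀,·) g₀ + Ė_1(t,t₀,·) g₁ ‖_{L²} ≤ C (‖g₀‖_{L²} + ‖|ξ|g₀‖_{L²} + ‖g₁‖_{L²}); (c) ‖ E_0(t,t₀,·) g₀ + E_1(t,t₀,·) g₁ ‖_{L²} ≤ C (1+t)^{1/2 + Re ν} (1+t₀)^{1/2 − Re ν} (‖g₀‖_{L²} + ‖g₁‖_{L²}). -/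
open MeasureTheory Real Set

noncomputable section

/-- Bessel function of the first kind `J_ν(τ)`, defined by its power series,
using the principal branch of `(τ/2)^(ν+2k)`. -/
def besselJ (ν : ℂ) (τ : ℝ) : ℂ :=
  ∑' k : ℕ, ((-1 : ℂ) ^ k / ((Nat.factorial k : ℂ) * Complex.Gamma (ν + k + 1))) *
    ((τ : ℂ) / 2) ^ (ν + 2 * (k : ℂ))

/-- Bessel function of the second kind (Neumann function) `Y_ν(τ)` for `ν ∉ ℤ`. -/
def besselY (ν : ℂ) (τ : ℝ) : ℂ :=
  (besselJ ν τ * Complex.cos (ν * (π : ℂ)) - besselJ (-ν) τ) / Complex.sin (ν * (π : ℂ))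

/-- The index `ν` associated with the mass parameter `μ`. -/
def nuOf (μ : ℝ) : ℂ :=
  if μ ≤ 1 / 4 then ((Real.sqrt (1 - 4 * μ) / 2 : ℝ) : ℂ)
  else Complex.I * ((Real.sqrt (4 * μ - 1) / 2 : ℝ) : ℂ)

/-- `e₊(t,ξ) = τ^{1/2} J_ν(τ)` with `τ = (1+t) r`, `r = |ξ|`. -/
def ePlus (ν : ℂ) (r t : ℝ) : ℂ :=
  (Real.sqrt ((1 + t) * r) : ℂ) * besselJ ν ((1 + t) * r)

/-- `e₋(t,ξ) = τ^{1/2} Y_ν(τ)` with `τ = (1+t) r`, `r = |ξ|`. -/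
def eMinus (ν : ℂ) (r t : ℝ) : ℂ :=
  (Real.sqrt ((1 + t) * r) : ℂ) * besselY ν ((1 + t) * r)

/-- `ė₊ = ∂ₜ e₊`. -/
def ePlusDot (ν : ℂ) (r t : ℝ) : ℂ := deriv (ePlus ν r) t

/-- `ė₋ = ∂ₜ e₋`. -/
def eMinusDot (ν : ℂ) (r t : ℝ) : ℂ := deriv (eMinus ν r) t

/-- The Fourier multiplier `E₀(t,t₀,ξ)` of the Klein–Gordon propagator. -/
def E0 (ν : ℂ) (r t t₀ : ℝ) : ℂ :=
  (ePlus ν r t * eMinusDot ν r t₀ - ePlusDot ν r t₀ * eMinus ν r t) /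
    (ePlus ν r t₀ * eMinusDot ν r t₀ - ePlusDot ν r t₀ * eMinus ν r t₀)

/-- The Fourier multiplier `E₁(t,t₀,ξ)` of the Klein–Gordon propagator. -/
def E1 (ν : ℂ) (r t t₀ : ℝ) : ℂ :=
  (ePlus ν r t₀ * eMinus ν r t - ePlus ν r t * eMinus ν r t₀) /
    (ePlus ν r t₀ * eMinusDot ν r t₀ - ePlusDot ν r t₀ * eMinus ν r t₀)

/-- `Ė₀ = ∂ₜ E₀` (derivative in the first time variable). -/
def E0dot (ν : ℂ) (r t t₀ : ℝ) : ℂ := deriv (fun s => E0 ν r s t₀) t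

/-- `Ė₁ = ∂ₜ E₁` (derivative in the first time variable). -/
def E1dot (ν : ℂ) (r t t₀ : ℝ) : ℂ := deriv (fun s => E1 ν r s t₀) t

/-- The Neumann function `Y₀(τ)` (logarithmic case `ν = 0`). -/
def besselY0 (τ : ℝ) : ℂ :=
  (2 / (π : ℂ)) * (Complex.log ((τ : ℂ) / 2) + (Real.eulerMascheroniConstant : ℂ)) * besselJ 0 τ +
    (2 / (π : ℂ)) * ∑' k : ℕ,
      ((-1 : ℂ) ^ ((k + 1) + 1) * ((harmonic (k + 1) : ℚ) : ℂ) /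
          ((Nat.factorial (k + 1) : ℂ)) ^ 2) * ((τ : ℂ) / 2) ^ (2 * (k + 1))

/-- `e₋(t,ξ) = τ^{1/2} Y₀(τ)` in the case `μ = 1/4`, `ν = 0`. -/
def eMinusZ (r t : ℝ) : ℂ :=
  (Real.sqrt ((1 + t) * r) : ℂ) * besselY0 ((1 + t) * r)

/-- `ė₋ = ∂ₜ e₋` in the case `μ = 1/4`. -/
def eMinusZDot (r t : ℝ) : ℂ := deriv (eMinusZ r) t

/-- `E₀(t,t₀,ξ)` in the case `μ = 1/4`, `ν = 0`. -/
def E0Z (r t t₀ : ℝ) : ℂ :=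
  (ePlus 0 r t * eMinusZDot r t₀ - ePlusDot 0 r t₀ * eMinusZ r t) /
    (ePlus 0 r t₀ * eMinusZDot r t₀ - ePlusDot 0 r t₀ * eMinusZ r t₀)

/-- `E₁(t,t₀,ξ)` in the case `μ = 1/4`, `ν = 0`. -/
def E1Z (r t t₀ : ℝ) : ℂ :=
  (ePlus 0 r t₀ * eMinusZ r t - ePlus 0 r t * eMinusZ r t₀) /
    (ePlus 0 r t₀ * eMinusZDot r t₀ - ePlusDot 0 r t₀ * eMinusZ r t₀)

/-- `Ė₀` in the case `μ = 1/4`. -/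
def E0Zdot (r t t₀ : ℝ) : ℂ := deriv (fun s => E0Z r s t₀) t

/-- `Ė₁` in the case `μ = 1/4`. -/
def E1Zdot (r t t₀ : ℝ) : ℂ := deriv (fun s => E1Z r s t₀) t

theorem hasDerivAt_tsum_mul_pow {a : ℕ → ℂ} {M R : ℝ} (hR : 0 ≤ R) (hM : 0 ≤ M)
    (ha : ∀ k, ‖a k‖ ≤ M * (R ^ k / k.factorial)) (w : ℂ) :
    HasDerivAt (fun w : ℂ => ∑' k, a k * w ^ k) (∑' k : ℕ, ((k : ℂ) + 1) * a (k + 1) * w ^ k) w := by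
  set ρ : ℝ := ‖w‖ + 1 with hρ
  have hρ1 : 1 ≤ ρ := by have := norm_nonneg w; linarith
  have hu : Summable fun k : ℕ => M * ((2 * R * ρ) ^ k / k.factorial) :=
    (Real.summable_pow_div_factorial _).mul_left M
  have hbound : ∀ k : ℕ, ∀ z ∈ Metric.ball (0 : ℂ) ρ,
      ‖a k * ((k : ℂ) * z ^ (k - 1))‖ ≤ M * ((2 * R * ρ) ^ k / k.factorial) := by
    intro k z hz
    have hz' : ‖z‖ ≤ ρ := (mem_ball_zero_iff.1 hz).le
    have hk : (k : ℝ) ≤ 2 ^ k := by exact_mod_cast k.lt_two_pow_self.le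
    have hzk : ‖z‖ ^ (k - 1) ≤ ρ ^ k :=
      (pow_le_pow_left₀ (norm_nonneg z) hz' _).trans (pow_le_pow_right₀ hρ1 (Nat.sub_le k 1))
    rw [norm_mul, norm_mul, norm_pow, Complex.norm_natCast]
    calc ‖a k‖ * ((k : ℝ) * ‖z‖ ^ (k - 1))
        ≤ (M * (R ^ k / k.factorial)) * (2 ^ k * ρ ^ k) := by
          gcongr
          exact ha k
      _ = _ := by rw [mul_pow, mul_pow]; ring
  have hw : w ∈ Metric.ball (0 : ℂ) ρ := by simp [hρ]
  have hsum : Summable fun k => a k * (0 : ℂ) ^ k :=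
    summable_of_ne_finset_zero (s := {0}) fun k hk => by
      simp only [Finset.mem_singleton] at hk
      simp [hk]
  have key := hasDerivAt_tsum_of_isPreconnected hu Metric.isOpen_ball
    (convex_ball (0 : ℂ) ρ).isPreconnected
    (fun k z _ => (hasDerivAt_pow k z).const_mul (a k)) hbound
    (Metric.mem_ball_self (by linarith)) hsum hw
  have hs : Summable fun k : ℕ => a k * ((k : ℂ) * w ^ (k - 1)) :=
    Summable.of_norm_bounded hu fun k => hbound k w hw
  refine key.congr_deriv ?_
  rw [hs.tsum_eq_zero_add]
  simp only [CharP.cast_eq_zero, zero_mul, mul_zero, zero_add, Nat.add_sub_cancel]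
  refine tsum_congr fun k => ?_
  push_cast
  ring

theorem summable_mul_pow_of_le {a : ℕ → ℂ} {M R : ℝ}
    (ha : ∀ k, ‖a k‖ ≤ M * (R ^ k / k.factorial)) (w : ℂ) :
    Summable fun k => a k * w ^ k := by
  refine Summable.of_norm_bounded
    ((Real.summable_pow_div_factorial (R * ‖w‖)).mul_left M) fun k => ?_
  rw [norm_mul, norm_pow, mul_pow]
  calc ‖a k‖ * ‖w‖ ^ k ≤ M * (R ^ k / k.factorial) * ‖w‖ ^ k := by gcongr; exact ha k
    _ = _ := by ring

theorem norm_succ_mul_succ_le {a : ℕ → ℂ} {M R : ℝ}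
    (ha : ∀ k, ‖a k‖ ≤ M * (R ^ k / k.factorial)) (k : ℕ) :
    ‖((k : ℂ) + 1) * a (k + 1)‖ ≤ M * R * (R ^ k / k.factorial) := by
  have h : ‖(k : ℂ) + 1‖ = k + 1 := by exact_mod_cast Complex.norm_natCast (k + 1)
  rw [norm_mul, h]
  calc ((k : ℝ) + 1) * ‖a (k + 1)‖
      ≤ (k + 1) * (M * (R ^ (k + 1) / (k + 1).factorial)) := by gcongr; exact ha _
    _ = _ := by
      rw [Nat.factorial_succ]
      push_cast
      have : (k : ℝ) + 1 ≠ 0 := by positivity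
      field_simp
      ring

/-- The coefficients of `(τ/2)^(ν+2k)` in the power series of `J_ν`. -/
def besselCoeff (ν : ℂ) (k : ℕ) : ℂ :=
  (-1 : ℂ) ^ k / ((Nat.factorial k : ℂ) * Complex.Gamma (ν + k + 1))

theorem besselCoeff_succ (ν : ℂ) (k : ℕ) :
    (ν + k + 1) * (((k : ℂ) + 1) * besselCoeff ν (k + 1)) = -besselCoeff ν k := by
  have h := Complex.one_div_Gamma_eq_self_mul_one_div_Gamma_add_one (ν + k + 1)
  have hk : (k : ℂ) + 1 ≠ 0 := by exact_mod_cast k.succ_ne_zero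
  have hf : ((Nat.factorial k : ℕ) : ℂ) ≠ 0 := by exact_mod_cast k.factorial_ne_zero
  have e : ν + (k : ℂ) + 1 + 1 = ν + ((k + 1 : ℕ) : ℂ) + 1 := by push_cast; ring
  rw [e] at h
  have h1 : besselCoeff ν k = (-1) ^ k / (Nat.factorial k : ℂ) * (Complex.Gamma (ν + k + 1))⁻¹ := by
    rw [besselCoeff]; ring
  have h2 : besselCoeff ν (k + 1) = (-1) ^ (k + 1) / (Nat.factorial (k + 1) : ℂ) *
      (Complex.Gamma (ν + ((k + 1 : ℕ) : ℂ) + 1))⁻¹ := by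
    rw [besselCoeff]; ring
  rw [h1, h2, h, Nat.factorial_succ]
  push_cast
  field_simp
  ring

theorem norm_besselCoeff_le {ν : ℂ} (hν : -(1 / 2) ≤ ν.re) (k : ℕ) :
    ‖besselCoeff ν k‖ ≤ ‖besselCoeff ν 0‖ * (2 ^ k / k.factorial) := by
  induction k with
  | zero => simp
  | succ k ih =>
    have h1 : (1 / 2 : ℝ) ≤ ‖ν + k + 1‖ := by
      refine le_trans ?_ (Complex.re_le_norm _)
      have : (0 : ℝ) ≤ k := k.cast_nonneg
      simp only [Complex.add_re, Complex.natCast_re, Complex.one_re]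
      linarith
    have h := congrArg norm (besselCoeff_succ ν k)
    have h2 : ‖(k : ℂ) + 1‖ = k + 1 := by exact_mod_cast Complex.norm_natCast (k + 1)
    rw [norm_mul, norm_mul, norm_neg, h2] at h
    have hk : (0 : ℝ) < k + 1 := by positivity
    have h3 : ((k : ℝ) + 1) * ‖besselCoeff ν (k + 1)‖ ≤ 2 * ‖besselCoeff ν k‖ := by
      have := mul_le_mul_of_nonneg_right h1
        (by positivity : 0 ≤ ((k : ℝ) + 1) * ‖besselCoeff ν (k + 1)‖)
      linarith
    rw [Nat.factorial_succ]
    push_cast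
    rw [← mul_le_mul_iff_right₀ hk]
    calc _ ≤ 2 * (‖besselCoeff ν 0‖ * (2 ^ k / k.factorial)) := by linarith
      _ = _ := by field_simp; ring

/-- The power series `F` with `J_ν(τ) = (τ/2)^ν F((τ/2)²)`, together with its first two derivatives
and the differential equation it satisfies. -/
theorem exists_besselSeries {ν : ℂ} (hν : -(1 / 2) ≤ ν.re) :
    ∃ F F₁ F₂ : ℂ → ℂ, (∀ w, F w = ∑' k, besselCoeff ν k * w ^ k) ∧
      (∀ w, HasDerivAt F (F₁ w) w) ∧ (∀ w, HasDerivAt F₁ (F₂ w) w) ∧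
      ∀ w, w * F₂ w + (ν + 1) * F₁ w + F w = 0 := by
  have h0 := norm_besselCoeff_le hν
  have h1 := norm_succ_mul_succ_le h0
  have h2 := norm_succ_mul_succ_le (a := fun k : ℕ => ((k : ℂ) + 1) * besselCoeff ν (k + 1)) h1
  refine ⟨_, _, _, fun w => rfl,
    fun w => hasDerivAt_tsum_mul_pow (by norm_num) (norm_nonneg _) h0 w,
    fun w => hasDerivAt_tsum_mul_pow (a := fun k : ℕ => ((k : ℂ) + 1) * besselCoeff ν (k + 1))
      (by norm_num) (by positivity) h1 w, fun w => ?_⟩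
  have s0 := summable_mul_pow_of_le h0 w
  have s1 := summable_mul_pow_of_le (a := fun k : ℕ => ((k : ℂ) + 1) * besselCoeff ν (k + 1)) h1 w
  have s2 : Summable fun k : ℕ => (k : ℂ) * (((k : ℂ) + 1) * besselCoeff ν (k + 1)) * w ^ k := by
    rw [← summable_nat_add_iff 1]
    refine ((summable_mul_pow_of_le h2 w).mul_left w).congr fun k => ?_
    push_cast
    ring
  have e : w * ∑' k : ℕ, ((k : ℂ) + 1) * (((k + 1 : ℕ) : ℂ) + 1) * besselCoeff ν (k + 1 + 1) * w ^ k
      = ∑' k : ℕ, (k : ℂ) * (((k : ℂ) + 1) * besselCoeff ν (k + 1)) * w ^ k := by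
    rw [s2.tsum_eq_zero_add, ← tsum_mul_left]
    simp only [CharP.cast_eq_zero, zero_mul, zero_add]
    refine tsum_congr fun k => ?_
    push_cast
    ring
  simp only [← mul_assoc] at *
  rw [e, ← tsum_mul_left, ← s2.tsum_add (s1.mul_left _),
    ← (s2.add (s1.mul_left _)).tsum_add s0]
  convert tsum_zero with k
  linear_combination w ^ k * besselCoeff_succ ν k

/-- `y` solves `y'' + (r² + μ (1+t)⁻²) y = 0` on `(-1, ∞)`, with derivative `v`. -/
def IsKGSolution (r μ : ℝ) (y v : ℝ → ℂ) : Prop :=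
  ∀ t, -1 < t → HasDerivAt y (v t) t ∧ HasDerivAt v ((-(r ^ 2 + μ / (1 + t) ^ 2)) • y t) t

namespace IsKGSolution

variable {r μ : ℝ} {y v y₁ v₁ y₂ v₂ : ℝ → ℂ}

theorem const_mul (h : IsKGSolution r μ y v) (c : ℂ) :
    IsKGSolution r μ (fun t => c * y t) (fun t => c * v t) := fun t ht =>
  ⟨(h t ht).1.const_mul c, ((h t ht).2.const_mul c).congr_deriv (mul_smul_comm _ _ _)⟩

theorem add (h₁ : IsKGSolution r μ y₁ v₁) (h₂ : IsKGSolution r μ y₂ v₂) :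
    IsKGSolution r μ (fun t => y₁ t + y₂ t) (fun t => v₁ t + v₂ t) := fun t ht =>
  ⟨(h₁ t ht).1.add (h₂ t ht).1, ((h₁ t ht).2.add (h₂ t ht).2).congr_deriv (smul_add _ _ _).symm⟩

theorem congr (h : IsKGSolution r μ y v) (hy : ∀ t, -1 < t → y₁ t = y t) :
    IsKGSolution r μ y₁ v := fun t ht => by
  refine ⟨(h t ht).1.congr_of_eventuallyEq ?_, by rw [hy t ht]; exact (h t ht).2⟩
  filter_upwards [Ioi_mem_nhds ht] with s hs using hy s hs

end IsKGSolution

theorem exists_isKGSolution_ePlus {ν : ℂ} {r μ : ℝ} (hr : 0 < r) (hν : -(1 / 2) ≤ ν.re)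
    (hμ : ν ^ 2 = 1 / 4 - μ) : ∃ v, IsKGSolution r μ (ePlus ν r) v := by
  obtain ⟨F, F₁, F₂, hF, hd, hd₁, hode⟩ := exists_besselSeries hν
  set p : ℂ := ν + 1 / 2 with hp
  have hg : ∀ s : ℂ, s ∈ Complex.slitPlane → HasDerivAt (fun s : ℂ => s ^ p * F (s ^ 2))
      (s ^ p * (p / s * F (s ^ 2) + 2 * s * F₁ (s ^ 2))) s := fun s hs => by
    have hs0 : s ≠ 0 := Complex.slitPlane_ne_zero hs
    have a := (hasDerivAt_id s).cpow_const (c := p) hs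
    have b := (hd (s ^ 2)).comp s (hasDerivAt_pow 2 s)
    refine (a.mul b).congr_deriv ?_
    simp only [id, Complex.cpow_sub _ _ hs0, Complex.cpow_one, Function.comp]
    push_cast
    field_simp
  have hg₁ : ∀ s : ℂ, s ∈ Complex.slitPlane →
      HasDerivAt (fun s : ℂ => s ^ p * (p / s * F (s ^ 2) + 2 * s * F₁ (s ^ 2)))
      ((p * (p - 1) / s ^ 2 - 4) * (s ^ p * F (s ^ 2))) s := fun s hs => by
    have hs0 : s ≠ 0 := Complex.slitPlane_ne_zero hs
    have a := (hasDerivAt_id s).cpow_const (c := p) hs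
    have b := (hd (s ^ 2)).comp s (hasDerivAt_pow 2 s)
    have c := (hd₁ (s ^ 2)).comp s (hasDerivAt_pow 2 s)
    have e := ((hasDerivAt_inv hs0).const_mul p).mul b
    have f := ((hasDerivAt_id s).const_mul 2).mul c
    refine (a.mul (e.add f)).congr_deriv ?_
    simp only [id, Complex.cpow_sub _ _ hs0, Complex.cpow_one, Function.comp, Pi.add_apply,
      Pi.mul_apply]
    have o := hode (s ^ 2)
    push_cast
    have o' : F₂ (s ^ 2) = -((ν + 1) * F₁ (s ^ 2) + F (s ^ 2)) / s ^ 2 := by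
      field_simp
      linear_combination o
    rw [o', hp]
    field_simp
    ring
  have hs : ∀ t : ℝ, HasDerivAt (fun t : ℝ => (((1 + t) * r / 2 : ℝ) : ℂ)) ((r / 2 : ℝ) : ℂ) t :=
    fun t => by
      refine HasDerivAt.ofReal_comp ?_
      simpa using (((hasDerivAt_id t).const_add 1).mul_const r).div_const 2
  have hsol : IsKGSolution r μ
      (fun t => (((1 + t) * r / 2 : ℝ) : ℂ) ^ p * F ((((1 + t) * r / 2 : ℝ) : ℂ) ^ 2))
      (fun t => ((r / 2 : ℝ) : ℂ) * ((((1 + t) * r / 2 : ℝ) : ℂ) ^ p *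
        (p / (((1 + t) * r / 2 : ℝ) : ℂ) * F ((((1 + t) * r / 2 : ℝ) : ℂ) ^ 2) +
          2 * (((1 + t) * r / 2 : ℝ) : ℂ) * F₁ ((((1 + t) * r / 2 : ℝ) : ℂ) ^ 2)))) := by
    intro t ht
    have h1t : 0 < 1 + t := by linarith
    have hpos : (((1 + t) * r / 2 : ℝ) : ℂ) ∈ Complex.slitPlane :=
      Complex.ofReal_mem_slitPlane.2 (by positivity)
    have a := (hg _ hpos).comp t (hs t)
    have b := ((hg₁ _ hpos).comp t (hs t)).const_mul ((r / 2 : ℝ) : ℂ)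
    refine ⟨a.congr_deriv (mul_comm _ _), b.congr_deriv ?_⟩
    have hpp : p * (p - 1) = -μ := by
      rw [hp]
      linear_combination hμ
    have h1c : (1 : ℂ) + t ≠ 0 := by exact_mod_cast h1t.ne'
    have hrc : (r : ℂ) ≠ 0 := by exact_mod_cast hr.ne'
    rw [hpp, Complex.real_smul]
    beta_reduce
    generalize (((1 + t) * r / 2 : ℝ) : ℂ) ^ p * F ((((1 + t) * r / 2 : ℝ) : ℂ) ^ 2) = z
    push_cast
    field_simp
    ring
  refine ⟨_, (hsol.const_mul ((√2 : ℝ) : ℂ)).congr fun t ht => ?_⟩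
  have h1t : 0 < 1 + t := by linarith
  set s : ℝ := (1 + t) * r / 2 with hsdef
  have hspos : 0 < s := by positivity
  have hsc : (s : ℂ) ≠ 0 := by exact_mod_cast hspos.ne'
  have hτ : (1 + t) * r = 2 * s := by rw [hsdef]; ring
  have hJ : besselJ ν (2 * s) = (s : ℂ) ^ ν * F ((s : ℂ) ^ 2) := by
    rw [besselJ, hF, ← tsum_mul_left]
    refine tsum_congr fun k => ?_
    have : ((2 * s : ℝ) : ℂ) / 2 = s := by push_cast; ring
    rw [this, Complex.cpow_add _ _ hsc, besselCoeff, ← pow_mul,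
      show (2 : ℂ) * k = ((2 * k : ℕ) : ℂ) by push_cast; rfl, Complex.cpow_natCast]
    ring
  rw [ePlus, hτ, hJ, hp, Complex.cpow_add _ _ hsc, Real.sqrt_mul (by norm_num),
    Real.sqrt_eq_rpow s, Complex.ofReal_mul, Complex.ofReal_cpow hspos.le]
  push_cast
  ring

theorem exists_isKGSolution_eMinus {ν : ℂ} {r μ : ℝ} (hr : 0 < r) (hν : |ν.re| ≤ 1 / 2)
    (hμ : ν ^ 2 = 1 / 4 - μ) : ∃ v, IsKGSolution r μ (eMinus ν r) v := by
  obtain ⟨h₁, h₂⟩ := abs_le.1 hν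
  obtain ⟨v₁, hv₁⟩ := exists_isKGSolution_ePlus hr h₁ hμ
  obtain ⟨v₂, hv₂⟩ := exists_isKGSolution_ePlus (ν := -ν) hr (by simpa using h₂)
    (by rw [neg_sq, hμ])
  refine ⟨_, ((hv₁.const_mul (Complex.cos (ν * π) / Complex.sin (ν * π))).add
    (hv₂.const_mul (-1 / Complex.sin (ν * π)))).congr fun t _ => ?_⟩
  simp only [eMinus, ePlus, besselY]
  ring

theorem le_of_hasDerivAt_nonpos {H H' : ℝ → ℝ} (hH : ∀ t, -1 < t → HasDerivAt H (H' t) t)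
    (hH' : ∀ t, -1 < t → H' t ≤ 0) {t₀ t : ℝ} (ht₀ : -1 < t₀) (ht : t₀ ≤ t) : H t ≤ H t₀ := by
  have hanti : AntitoneOn H (Ioi (-1)) := by
    refine antitoneOn_of_deriv_nonpos (convex_Ioi _)
      (fun s hs => (hH s hs).continuousAt.continuousWithinAt) ?_ ?_
    · rw [interior_Ioi]
      exact fun s hs => (hH s hs).differentiableAt.differentiableWithinAt
    · rw [interior_Ioi]
      intro s hs
      rw [(hH s hs).deriv]
      exact hH' s hs
  exact hanti ht₀ (ht₀.trans_le ht) ht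

theorem hasDerivAt_one_add_rpow {t : ℝ} (ht : -1 < t) (a : ℝ) :
    HasDerivAt (fun t : ℝ => (1 + t) ^ a) (a * (1 + t) ^ a / (1 + t)) t := by
  have h1t : 0 < 1 + t := by linarith
  refine (((hasDerivAt_id t).const_add 1).rpow_const (p := a) (Or.inl h1t.ne')).congr_deriv ?_
  simp only [id]
  rw [Real.rpow_sub_one h1t.ne']
  ring

theorem hasDerivAt_div_one_add_sq {t : ℝ} (ht : -1 < t) (c : ℝ) :
    HasDerivAt (fun t : ℝ => c / (1 + t) ^ 2) (-2 * c / (1 + t) ^ 3) t := by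
  have h1t : 0 < 1 + t := by linarith
  have h := ((hasDerivAt_id t).const_add 1).pow 2
  refine ((hasDerivAt_const t c).div h (by simp only [id, Pi.pow_apply]; positivity)).congr_deriv ?_
  simp only [id, Pi.pow_apply]
  field_simp
  ring

theorem IsKGSolution.energy_le {r μ : ℝ} {y v : ℝ → ℂ} (h : IsKGSolution r μ y v) (hμ : 0 ≤ μ)
    {t₀ t : ℝ} (ht₀ : -1 < t₀) (ht : t₀ ≤ t) :
    ‖v t‖ ^ 2 + (r ^ 2 + μ / (1 + t) ^ 2) * ‖y t‖ ^ 2 ≤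
      ‖v t₀‖ ^ 2 + (r ^ 2 + μ / (1 + t₀) ^ 2) * ‖y t₀‖ ^ 2 := by
  refine le_of_hasDerivAt_nonpos (H := fun t => ‖v t‖ ^ 2 + (r ^ 2 + μ / (1 + t) ^ 2) * ‖y t‖ ^ 2)
    (H' := fun t => -2 * μ / (1 + t) ^ 3 * ‖y t‖ ^ 2) (fun s hs => ?_) (fun s hs => ?_) ht₀ ht
  · refine ((h s hs).2.norm_sq.add
      (((hasDerivAt_div_one_add_sq hs μ).const_add (r ^ 2)).mul (h s hs).1.norm_sq)).congr_deriv ?_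
    rw [real_inner_smul_right, real_inner_comm]
    ring
  · have : 0 < 1 + s := by linarith
    have : 0 ≤ 2 * μ / (1 + s) ^ 3 * ‖y s‖ ^ 2 := by positivity
    calc _ = -(2 * μ / (1 + s) ^ 3 * ‖y s‖ ^ 2) := by ring
      _ ≤ 0 := by linarith

/-- `z` solves `z'' + 2p (1+t)⁻¹ z' + (r² + m (1+t)⁻²) z = 0` on `(-1, ∞)`, with derivative `ζ`. -/
def IsDampedSolution (r m p : ℝ) (z ζ : ℝ → ℂ) : Prop :=
  ∀ t, -1 < t → HasDerivAt z (ζ t) t ∧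
    HasDerivAt ζ ((-(2 * p / (1 + t))) • ζ t + (-(r ^ 2 + m / (1 + t) ^ 2)) • z t) t

theorem IsKGSolution.isDampedSolution {r μ : ℝ} {y v : ℝ → ℂ} (h : IsKGSolution r μ y v) (p : ℝ) :
    IsDampedSolution r (μ + p * (p - 1)) p (fun t => (1 + t) ^ (-p) • y t)
      (fun t => (1 + t) ^ (-p) • v t - (p * (1 + t) ^ (-p) / (1 + t)) • y t) := by
  intro t ht
  have h1t : 0 < 1 + t := by linarith
  have h1c : (1 : ℂ) + t ≠ 0 := by exact_mod_cast h1t.ne'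
  have hy := (h t ht).1
  have hv := (h t ht).2
  have hx := hasDerivAt_one_add_rpow ht (-p)
  constructor
  · refine (hx.smul hy).congr_deriv ?_
    simp only [Complex.real_smul]
    push_cast
    ring
  · have hq := (hx.const_mul p).div ((hasDerivAt_id t).const_add 1) (by simpa using h1t.ne')
    refine ((hx.smul hv).sub (hq.smul hy)).congr_deriv ?_
    simp only [Complex.real_smul, id, Pi.div_apply]
    generalize (1 + t) ^ (-p) = X
    push_cast
    field_simp
    ring

/-- For `p = 1/2` and `m > 0` the energy divided by `r² + m (1+t)⁻²` is nonincreasing. -/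
theorem IsDampedSolution.norm_sq_le_of_half {r m : ℝ} {z ζ : ℝ → ℂ}
    (h : IsDampedSolution r m (1 / 2) z ζ) (hm : 0 < m) {t₀ t : ℝ} (ht₀ : -1 < t₀) (ht : t₀ ≤ t) :
    ‖z t‖ ^ 2 ≤ ‖z t₀‖ ^ 2 + (1 + t₀) ^ 2 / m * ‖ζ t₀‖ ^ 2 := by
  have hw : ∀ s, -1 < s → 0 < r ^ 2 + m / (1 + s) ^ 2 := fun s hs => by
    have : 0 < 1 + s := by linarith
    positivity
  have key : ‖z t‖ ^ 2 + ‖ζ t‖ ^ 2 / (r ^ 2 + m / (1 + t) ^ 2) ≤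
      ‖z t₀‖ ^ 2 + ‖ζ t₀‖ ^ 2 / (r ^ 2 + m / (1 + t₀) ^ 2) := by
    refine le_of_hasDerivAt_nonpos
      (H := fun t => ‖z t‖ ^ 2 + ‖ζ t‖ ^ 2 / (r ^ 2 + m / (1 + t) ^ 2))
      (H' := fun t => -(2 * r ^ 2 / (1 + t) * ‖ζ t‖ ^ 2 / (r ^ 2 + m / (1 + t) ^ 2) ^ 2))
      (fun s hs => ?_) (fun s hs => ?_) ht₀ ht
    · have h1 : 0 < 1 + s := by linarith
      have hws := (hw s hs).ne'
      refine ((h s hs).1.norm_sq.add ((h s hs).2.norm_sq.div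
        ((hasDerivAt_div_one_add_sq hs m).const_add (r ^ 2)) hws)).congr_deriv ?_
      rw [inner_add_right, real_inner_smul_right, real_inner_smul_right, real_inner_comm,
        real_inner_self_eq_norm_sq]
      rw [show -2 * m / (1 + s) ^ 3 = -2 * (r ^ 2 + m / (1 + s) ^ 2) / (1 + s) + 2 * r ^ 2 / (1 + s)
        by field_simp; ring]
      generalize r ^ 2 + m / (1 + s) ^ 2 = w at *
      field_simp
      ring
    · have : 0 < 1 + s := by linarith
      rw [neg_nonpos]
      positivity
  have h0 : 0 < 1 + t₀ := by linarith
  have h1 : ‖ζ t₀‖ ^ 2 / (r ^ 2 + m / (1 + t₀) ^ 2) ≤ ‖ζ t₀‖ ^ 2 / (m / (1 + t₀) ^ 2) := by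
    gcongr
    nlinarith [sq_nonneg r]
  have h2 : 0 ≤ ‖ζ t‖ ^ 2 / (r ^ 2 + m / (1 + t) ^ 2) :=
    div_nonneg (sq_nonneg _) (hw t (ht₀.trans_le ht)).le
  have h3 : ‖ζ t₀‖ ^ 2 / (m / (1 + t₀) ^ 2) = (1 + t₀) ^ 2 / m * ‖ζ t₀‖ ^ 2 := by
    field_simp
  linarith

/-- For `p > 1/2` and `m = 0`, a weighted energy grows at most by a constant factor: here
`φ = ((1+t)/(1+t₀))^(-b)` with `b = 2p - 1`, and the weight is `r² + φ (1+t)⁻²`. -/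
theorem IsDampedSolution.norm_sq_le_of_half_lt {r b : ℝ} {z ζ : ℝ → ℂ}
    (h : IsDampedSolution r 0 ((1 + b) / 2) z ζ) (hb : 0 < b) {t₀ t : ℝ} (ht₀ : -1 < t₀)
    (ht : t₀ ≤ t) :
    ‖z t‖ ^ 2 ≤ Real.exp (1 / b ^ 2) * (‖z t₀‖ ^ 2 + (1 + t₀) ^ 2 * ‖ζ t₀‖ ^ 2) := by
  have h0 : 0 < 1 + t₀ := by linarith
  set φ : ℝ → ℝ := fun s => (1 + t₀) ^ b * (1 + s) ^ (-b) with hφ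
  have hφpos : ∀ s, -1 < s → 0 < φ s := fun s hs => by
    have : 0 < 1 + s := by linarith
    simp only [hφ]
    positivity
  have hφd : ∀ s, -1 < s → HasDerivAt φ (-b * φ s / (1 + s)) s := fun s hs =>
    ((hasDerivAt_one_add_rpow hs (-b)).const_mul ((1 + t₀) ^ b)).congr_deriv (by
      simp only [hφ]; ring)
  have hφ0 : φ t₀ = 1 := by
    simp only [hφ]
    rw [← Real.rpow_add h0, add_neg_cancel, Real.rpow_zero]
  set w : ℝ → ℝ := fun s => r ^ 2 + φ s / (1 + s) ^ 2 with hwdef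
  have hw : ∀ s, -1 < s → 0 < w s := fun s hs => by
    have : 0 < 1 + s := by linarith
    have := hφpos s hs
    simp only [hwdef]
    positivity
  have hwd : ∀ s, -1 < s → HasDerivAt w (-(2 + b) * φ s / (1 + s) ^ 3) s := fun s hs => by
    have h1 : 0 < 1 + s := by linarith
    refine (((hφd s hs).div (((hasDerivAt_id s).const_add 1).pow 2)
      (by simp only [id, Pi.pow_apply]; positivity)).const_add (r ^ 2)).congr_deriv ?_
    simp only [id, Pi.pow_apply]
    field_simp
    ring
  have key : Real.exp (φ t / b ^ 2) * (‖z t‖ ^ 2 + ‖ζ t‖ ^ 2 / w t) ≤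
      Real.exp (φ t₀ / b ^ 2) * (‖z t₀‖ ^ 2 + ‖ζ t₀‖ ^ 2 / w t₀) := by
    refine le_of_hasDerivAt_nonpos
      (H := fun t => Real.exp (φ t / b ^ 2) * (‖z t‖ ^ 2 + ‖ζ t‖ ^ 2 / w t))
      (H' := fun s => Real.exp (φ s / b ^ 2) *
        (2 * inner ℝ (z s) (ζ s) * (φ s / (1 + s) ^ 2 / w s)
          - ‖ζ s‖ ^ 2 * ((2 * (1 + b)) / ((1 + s) * w s) - (2 + b) * φ s / (1 + s) ^ 3 / w s ^ 2)
          - φ s / (b * (1 + s)) * (‖z s‖ ^ 2 + ‖ζ s‖ ^ 2 / w s)))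
      (fun s hs => ?_) (fun s hs => ?_) ht₀ ht
    · have h1 : 0 < 1 + s := by linarith
      have hws := (hw s hs).ne'
      refine ((((hφd s hs).div_const (b ^ 2)).exp).mul ((h s hs).1.norm_sq.add
        ((h s hs).2.norm_sq.div (hwd s hs) hws))).congr_deriv ?_
      rw [inner_add_right, real_inner_smul_right, real_inner_smul_right, real_inner_comm,
        real_inner_self_eq_norm_sq]
      simp only [Pi.add_apply, Pi.div_apply]
      have hr : r ^ 2 + 0 / (1 + s) ^ 2 = w s - φ s / (1 + s) ^ 2 := by simp only [hwdef]; ring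
      rw [hr]
      generalize w s = W at *
      generalize φ s = P at *
      field_simp
      ring
    · have h1 : 0 < 1 + s := by linarith
      have hws := hw s hs
      have hP := hφpos s hs
      refine mul_nonpos_of_nonneg_of_nonpos (Real.exp_pos _).le ?_
      have hin : inner ℝ (z s) (ζ s) ≤ ‖z s‖ * ‖ζ s‖ := real_inner_le_norm _ _
      have hPw : φ s / (1 + s) ^ 2 ≤ w s := by
        simp only [hwdef]
        nlinarith [sq_nonneg r]
      generalize inner ℝ (z s) (ζ s) = I at *
      generalize w s = W at *
      generalize φ s = P at *
      generalize ‖z s‖ = Z at *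
      generalize ‖ζ s‖ = N at *
      generalize 1 + s = x at *
      obtain ⟨q, rfl⟩ : ∃ q, P = q * x ^ 2 := ⟨P / x ^ 2, by field_simp⟩
      have hq : 0 < q := by
        by_contra hq
        nlinarith [sq_nonneg x]
      have hqW : q ≤ W := by
        rwa [mul_div_assoc, div_self (by positivity), mul_one] at hPw
      have e1 : 2 * I * (q * x ^ 2 / x ^ 2 / W) ≤ 2 * (Z * N) * (q / W) := by
        rw [mul_div_assoc, div_self (by positivity), mul_one]
        gcongr
      have e2 : b * N ^ 2 / (x * W) ≤
          N ^ 2 * (2 * (1 + b) / (x * W) - (2 + b) * (q * x ^ 2) / x ^ 3 / W ^ 2) := by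
        have : N ^ 2 * (2 * (1 + b) / (x * W) - (2 + b) * (q * x ^ 2) / x ^ 3 / W ^ 2)
            - b * N ^ 2 / (x * W) = N ^ 2 * (2 + b) * (W - q) / (x * W ^ 2) := by
          field_simp
          ring
        have h2 : 0 ≤ N ^ 2 * (2 + b) * (W - q) / (x * W ^ 2) := by
          have : 0 ≤ W - q := by linarith
          positivity
        linarith
      have e3 : q * x / b * Z ^ 2 ≤ q * x ^ 2 / (b * x) * (Z ^ 2 + N ^ 2 / W) := by
        have : q * x ^ 2 / (b * x) * (Z ^ 2 + N ^ 2 / W)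
            - q * x / b * Z ^ 2 = q * x / b * (N ^ 2 / W) := by
          field_simp
          ring
        have h2 : 0 ≤ q * x / b * (N ^ 2 / W) := by positivity
        linarith
      have e4 : 2 * (Z * N) * (q / W) ≤ b * N ^ 2 / (x * W) + q * x / b * Z ^ 2 := by
        have e : b * N ^ 2 / (x * W) + q * x / b * Z ^ 2 - 2 * (Z * N) * (q / W)
            = ((b * N - q * x * Z) ^ 2 + q * x ^ 2 * Z ^ 2 * (W - q)) / (b * x * W) := by
          field_simp
          ring
        have : 0 ≤ ((b * N - q * x * Z) ^ 2 + q * x ^ 2 * Z ^ 2 * (W - q)) / (b * x * W) := by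
          have : 0 ≤ W - q := by linarith
          positivity
        linarith
      linarith
  have ht1 := ht₀.trans_le ht
  have h2 : ‖z t‖ ^ 2 ≤ Real.exp (φ t / b ^ 2) * (‖z t‖ ^ 2 + ‖ζ t‖ ^ 2 / w t) := by
    have h3 : 0 ≤ ‖ζ t‖ ^ 2 / w t := div_nonneg (sq_nonneg _) (hw t ht1).le
    have h4 : 1 ≤ Real.exp (φ t / b ^ 2) :=
      Real.one_le_exp (div_nonneg (hφpos t ht1).le (sq_nonneg b))
    nlinarith [sq_nonneg ‖z t‖]
  have h5 : ‖ζ t₀‖ ^ 2 / w t₀ ≤ (1 + t₀) ^ 2 * ‖ζ t₀‖ ^ 2 := by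
    have h6 : ‖ζ t₀‖ ^ 2 / w t₀ ≤ ‖ζ t₀‖ ^ 2 / (1 / (1 + t₀) ^ 2) := by
      gcongr
      simp only [hwdef, hφ0]
      nlinarith [sq_nonneg r]
    calc _ ≤ _ := h6
      _ = _ := by field_simp
  rw [hφ0] at key
  refine h2.trans (key.trans ?_)
  gcongr

theorem norm_le_of_norm_sq_rpow_smul_le {y v : ℝ → ℂ} {p K t₀ t : ℝ} (hp : 0 ≤ p)
    (hK : 0 ≤ K) (ht₀ : 0 ≤ t₀) (ht : t₀ ≤ t)
    (h : ‖(1 + t) ^ (-p) • y t‖ ^ 2 ≤ K * (‖(1 + t₀) ^ (-p) • y t₀‖ ^ 2 + (1 + t₀) ^ 2 *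
      ‖(1 + t₀) ^ (-p) • v t₀ - (p * (1 + t₀) ^ (-p) / (1 + t₀)) • y t₀‖ ^ 2)) :
    ‖y t‖ ≤ √K * (1 + p) * (1 + t) ^ p * (1 + t₀) ^ (1 - p) * (‖y t₀‖ + ‖v t₀‖) := by
  have h0 : 0 < 1 + t₀ := by linarith
  have h1 : 0 < 1 + t := by linarith
  have hX : 0 < (1 + t) ^ (-p) := Real.rpow_pos_of_pos h1 _
  have hX₀ : 0 < (1 + t₀) ^ (-p) := Real.rpow_pos_of_pos h0 _
  have hB : ‖(1 + t₀) ^ (-p) • v t₀ - (p * (1 + t₀) ^ (-p) / (1 + t₀)) • y t₀‖ ≤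
      (1 + t₀) ^ (-p) * ‖v t₀‖ + p * (1 + t₀) ^ (-p) / (1 + t₀) * ‖y t₀‖ := by
    refine (norm_sub_le _ _).trans_eq ?_
    rw [norm_smul_of_nonneg hX₀.le, norm_smul_of_nonneg (by positivity)]
  rw [norm_smul_of_nonneg hX.le, norm_smul_of_nonneg hX₀.le] at h
  have hsq : (1 + t) ^ (-p) * ‖y t‖ ≤ √K * ((1 + t₀) ^ (-p) * ‖y t₀‖ + (1 + t₀) *
      ‖(1 + t₀) ^ (-p) • v t₀ - (p * (1 + t₀) ^ (-p) / (1 + t₀)) • y t₀‖) := by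
    refine le_of_sq_le_sq (h.trans ?_) (by positivity)
    rw [mul_pow √K, Real.sq_sqrt hK, ← mul_pow (1 + t₀)]
    gcongr
    have : 0 ≤ ((1 + t₀) ^ (-p) * ‖y t₀‖) * ((1 + t₀) *
      ‖(1 + t₀) ^ (-p) • v t₀ - (p * (1 + t₀) ^ (-p) / (1 + t₀)) • y t₀‖) := by positivity
    linarith [add_sq ((1 + t₀) ^ (-p) * ‖y t₀‖) ((1 + t₀) *
      ‖(1 + t₀) ^ (-p) • v t₀ - (p * (1 + t₀) ^ (-p) / (1 + t₀)) • y t₀‖)]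
  have hmul : (1 + t) ^ p * (1 + t) ^ (-p) = 1 := by
    rw [← Real.rpow_add h1, add_neg_cancel, Real.rpow_zero]
  have hX₁ : (1 + t₀) ^ (1 - p) = (1 + t₀) * (1 + t₀) ^ (-p) := by
    rw [sub_eq_add_neg, Real.rpow_add h0, Real.rpow_one]
  have hsum : (1 + t₀) ^ (-p) * ‖y t₀‖ + (1 + t₀) *
      ((1 + t₀) ^ (-p) * ‖v t₀‖ + p * (1 + t₀) ^ (-p) / (1 + t₀) * ‖y t₀‖) ≤
      (1 + p) * (1 + t₀) ^ (1 - p) * (‖y t₀‖ + ‖v t₀‖) := by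
    have e : (1 + p) * (1 + t₀) ^ (1 - p) * (‖y t₀‖ + ‖v t₀‖) - ((1 + t₀) ^ (-p) * ‖y t₀‖ +
        (1 + t₀) * ((1 + t₀) ^ (-p) * ‖v t₀‖ + p * (1 + t₀) ^ (-p) / (1 + t₀) * ‖y t₀‖)) =
        (1 + t₀) ^ (-p) * ((1 + p) * t₀ * ‖y t₀‖ + p * (1 + t₀) * ‖v t₀‖) := by
      rw [hX₁]
      field_simp
      ring
    have : 0 ≤ (1 + t₀) ^ (-p) * ((1 + p) * t₀ * ‖y t₀‖ + p * (1 + t₀) * ‖v t₀‖) := by positivity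
    linarith
  calc ‖y t‖ = (1 + t) ^ p * ((1 + t) ^ (-p) * ‖y t‖) := by rw [← mul_assoc, hmul, one_mul]
    _ ≤ (1 + t) ^ p * (√K * ((1 + p) * (1 + t₀) ^ (1 - p) * (‖y t₀‖ + ‖v t₀‖))) := by
      refine mul_le_mul_of_nonneg_left (hsq.trans ?_) (by positivity)
      refine mul_le_mul_of_nonneg_left (le_trans ?_ hsum) (Real.sqrt_nonneg K)
      gcongr
    _ = _ := by ring

theorem exists_norm_le_rpow {μ : ℝ} (hμ' : μ ≠ 1 / 4) :
    ∃ C > (0 : ℝ), ∀ (r : ℝ) (y v : ℝ → ℂ), IsKGSolution r μ y v → ∀ t t₀ : ℝ, 0 ≤ t₀ → t₀ ≤ t →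
      ‖y t‖ ≤ C * (1 + t) ^ (1 / 2 + (nuOf μ).re) * (1 + t₀) ^ (1 / 2 - (nuOf μ).re) *
        (‖y t₀‖ + ‖v t₀‖) := by
  rcases lt_or_gt_of_ne hμ' with hlt | hgt
  · set b : ℝ := √(1 - 4 * μ) with hb
    have hbpos : 0 < b := Real.sqrt_pos.2 (by linarith)
    have hb2 : b ^ 2 = 1 - 4 * μ := Real.sq_sqrt (by linarith)
    have hν : (nuOf μ).re = b / 2 := by rw [nuOf, if_pos hlt.le, Complex.ofReal_re]
    refine ⟨√(Real.exp (1 / b ^ 2)) * (1 + (1 + b) / 2), by positivity,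
      fun r y v h t t₀ ht₀ ht => ?_⟩
    have hm : μ + (1 + b) / 2 * ((1 + b) / 2 - 1) = 0 := by linear_combination hb2 / 4
    have hd := h.isDampedSolution ((1 + b) / 2)
    rw [hm] at hd
    have := norm_le_of_norm_sq_rpow_smul_le (by positivity)
      (Real.exp_pos _).le ht₀ ht (hd.norm_sq_le_of_half_lt hbpos (by linarith) ht)
    rw [hν]
    convert this using 4 <;> ring_nf
  · have hν : (nuOf μ).re = 0 := by
      rw [nuOf, if_neg (not_le.2 hgt), Complex.re_mul_ofReal, Complex.I_re, zero_mul]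
    have hm : 0 < μ + 1 / 2 * (1 / 2 - 1) := by linarith
    set m := μ + 1 / 2 * (1 / 2 - 1) with hmdef
    refine ⟨√(1 + 1 / m) * (1 + 1 / 2), by positivity, fun r y v h t t₀ ht₀ ht => ?_⟩
    have hd := (h.isDampedSolution (1 / 2)).norm_sq_le_of_half hm (by linarith) ht
    have := norm_le_of_norm_sq_rpow_smul_le (p := 1 / 2) (K := 1 + 1 / m)
      (v := v) (by norm_num) (by positivity) ht₀ ht (hd.trans ?_)
    · rw [hν, add_zero, sub_zero]
      rwa [show (1 : ℝ) - 1 / 2 = 1 / 2 by norm_num] at this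
    · have h1 : 0 ≤ 1 / m * ‖(1 + t₀) ^ (-(1 / 2) : ℝ) • y t₀‖ ^ 2 := by positivity
      have h2 : 0 ≤ (1 + t₀) ^ 2 * ‖(1 + t₀) ^ (-(1 / 2) : ℝ) • v t₀ -
        (1 / 2 * (1 + t₀) ^ (-(1 / 2) : ℝ) / (1 + t₀)) • y t₀‖ ^ 2 := by positivity
      rw [div_eq_mul_one_div ((1 + t₀) ^ 2) m]
      linarith

theorem nuOf_sq (μ : ℝ) : nuOf μ ^ 2 = 1 / 4 - μ := by
  rw [nuOf]
  split_ifs with h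
  · have := Real.sq_sqrt (show 0 ≤ 1 - 4 * μ by linarith)
    rw [← Complex.ofReal_pow, div_pow, this]
    push_cast
    ring
  · have := Real.sq_sqrt (show 0 ≤ 4 * μ - 1 by linarith)
    rw [mul_pow, ← Complex.ofReal_pow, div_pow, this, Complex.I_sq]
    push_cast
    ring

theorem abs_re_nuOf_le {μ : ℝ} (hμ : 0 ≤ μ) : |(nuOf μ).re| ≤ 1 / 2 := by
  rw [nuOf]
  split_ifs with h
  · rw [Complex.ofReal_re, abs_of_nonneg (by positivity)]
    have : √(1 - 4 * μ) ≤ 1 := Real.sqrt_le_one.2 (by linarith)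
    linarith
  · rw [Complex.re_mul_ofReal, Complex.I_re, zero_mul, abs_zero]
    norm_num

/-- `E₀ a + E₁ b` is the solution with data `(a, b)` at time `t₀`, or zero if the Wronskian
in the denominator vanishes. -/
theorem exists_isKGSolution_propagator {μ r : ℝ} (hμ : 0 ≤ μ) (hr : 0 ≤ r) {t₀ : ℝ} (ht₀ : -1 < t₀)
    (a b : ℂ) : ∃ y v : ℝ → ℂ, IsKGSolution r μ y v ∧ ‖y t₀‖ ≤ ‖a‖ ∧ ‖v t₀‖ ≤ ‖b‖ ∧
      ∀ t, -1 < t → E0 (nuOf μ) r t t₀ * a + E1 (nuOf μ) r t t₀ * b = y t ∧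
        E0dot (nuOf μ) r t t₀ * a + E1dot (nuOf μ) r t t₀ * b = v t := by
  set ν := nuOf μ with hν
  set W := ePlus ν r t₀ * eMinusDot ν r t₀ - ePlusDot ν r t₀ * eMinus ν r t₀ with hW
  by_cases hW0 : W = 0
  · have hE0 : ∀ t, E0 ν r t t₀ = 0 := fun t => by rw [E0, ← hW, hW0, div_zero]
    have hE1 : ∀ t, E1 ν r t t₀ = 0 := fun t => by rw [E1, ← hW, hW0, div_zero]
    refine ⟨fun _ => 0, fun _ => 0, fun t _ => ⟨hasDerivAt_const _ _, ?_⟩, by simp, by simp,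
      fun t _ => ?_⟩
    · simpa using hasDerivAt_const t (0 : ℂ)
    · simp [E0dot, E1dot, hE0, hE1]
  have hr0 : 0 < r := by
    refine hr.lt_of_ne' fun h0 => hW0 ?_
    simp [hW, ePlus, eMinus, h0]
  obtain ⟨vp, hp⟩ := exists_isKGSolution_ePlus hr0 (abs_le.1 (abs_re_nuOf_le hμ)).1 (nuOf_sq μ)
  obtain ⟨vm, hm⟩ := exists_isKGSolution_eMinus hr0 (abs_re_nuOf_le hμ) (nuOf_sq μ)
  have hp0 : ePlusDot ν r t₀ = vp t₀ := (hp t₀ ht₀).1.deriv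
  have hm0 : eMinusDot ν r t₀ = vm t₀ := (hm t₀ ht₀).1.deriv
  have h0 := (hp.const_mul (eMinusDot ν r t₀ / W)).add (hm.const_mul (-ePlusDot ν r t₀ / W))
  have h1 := (hp.const_mul (-eMinus ν r t₀ / W)).add (hm.const_mul (ePlus ν r t₀ / W))
  have hE0 : ∀ t, E0 ν r t t₀ =
      eMinusDot ν r t₀ / W * ePlus ν r t + -ePlusDot ν r t₀ / W * eMinus ν r t := fun t => by
    rw [E0, ← hW]; ring
  have hE1 : ∀ t, E1 ν r t t₀ =
      -eMinus ν r t₀ / W * ePlus ν r t + ePlus ν r t₀ / W * eMinus ν r t := fun t => by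
    rw [E1, ← hW]; ring
  refine ⟨_, _, (h0.const_mul a).add (h1.const_mul b), le_of_eq (congrArg norm ?_),
    le_of_eq (congrArg norm ?_), fun t ht => ⟨?_, ?_⟩⟩
  · calc _ = (a * W) / W := by rw [hW]; ring
      _ = a := mul_div_cancel_right₀ _ hW0
  · calc _ = (b * W) / W := by rw [hW, hp0, hm0]; ring
      _ = b := mul_div_cancel_right₀ _ hW0
  · rw [hE0, hE1]
    ring
  · have d0 : E0dot ν r t t₀ = _ := (((h0 t ht).1).congr_of_eventuallyEq
      (Filter.Eventually.of_forall hE0)).deriv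
    have d1 : E1dot ν r t t₀ = _ := (((h1 t ht).1).congr_of_eventuallyEq
      (Filter.Eventually.of_forall hE1)).deriv
    rw [d0, d1]
    ring

theorem IsKGSolution.mul_norm_le_and_norm_le {r μ : ℝ} {y v : ℝ → ℂ} (h : IsKGSolution r μ y v)
    (hμ : 0 ≤ μ) (hr : 0 ≤ r) {t₀ t : ℝ} (ht₀ : 0 ≤ t₀) (ht : t₀ ≤ t) :
    r * ‖y t‖ ≤ (1 + μ) * (‖y t₀‖ + r * ‖y t₀‖ + ‖v t₀‖) ∧
      ‖v t‖ ≤ (1 + μ) * (‖y t₀‖ + r * ‖y t₀‖ + ‖v t₀‖) := by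
  have hE := h.energy_le hμ (by linarith) ht
  have h1 : 0 < 1 + t := by linarith
  have h2 : μ / (1 + t₀) ^ 2 ≤ μ := div_le_self hμ (by nlinarith)
  have h3 : 0 ≤ μ / (1 + t) ^ 2 * ‖y t‖ ^ 2 := by positivity
  have h4 := mul_le_mul_of_nonneg_right h2 (sq_nonneg ‖y t₀‖)
  have hA := norm_nonneg (y t₀)
  have hB := norm_nonneg (v t₀)
  have key : ‖v t₀‖ ^ 2 + (r ^ 2 + μ) * ‖y t₀‖ ^ 2 ≤
      ((1 + μ) * (‖y t₀‖ + r * ‖y t₀‖ + ‖v t₀‖)) ^ 2 := by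
    generalize ‖y t₀‖ = A at *
    generalize ‖v t₀‖ = B at *
    have hrA : 0 ≤ r * A := mul_nonneg hr hA
    have e1 : A ^ 2 + (r * A) ^ 2 + B ^ 2 ≤ (A + r * A + B) ^ 2 := by
      have := mul_nonneg hA hrA
      have := mul_nonneg hA hB
      have := mul_nonneg hrA hB
      nlinarith
    calc B ^ 2 + (r ^ 2 + μ) * A ^ 2 ≤ (1 + μ) ^ 2 * (A ^ 2 + (r * A) ^ 2 + B ^ 2) := by
          have : 0 ≤ (1 + μ + μ ^ 2) * A ^ 2 + (2 * μ + μ ^ 2) * ((r * A) ^ 2 + B ^ 2) := by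
            positivity
          linarith
      _ ≤ (1 + μ) ^ 2 * (A + r * A + B) ^ 2 := by gcongr
      _ = _ := by ring
  constructor
  · refine le_of_sq_le_sq (le_trans ?_ key) (by positivity)
    nlinarith [sq_nonneg ‖v t‖]
  · refine le_of_sq_le_sq (le_trans ?_ key) (by positivity)
    nlinarith [mul_nonneg (sq_nonneg r) (sq_nonneg ‖y t‖)]

/-- energy estimates (Fourier formulation) for `μ > 0`, `μ ≠ 1/4`. -/
theorem stmt13 (μ : ℝ) (hμ : 0 < μ) (hμ' : μ ≠ 1 / 4) (d : ℕ) (hd : 1 ≤ d) :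
    ∃ C > (0 : ℝ), ∀ t t₀ : ℝ, 0 ≤ t₀ → t₀ ≤ t →
      ∀ g₀ g₁ : EuclideanSpace ℝ (Fin d) → ℂ, Measurable g₀ → Measurable g₁ →
        eLpNorm g₀ 2 volume < ⊤ →
        eLpNorm (fun ξ => (‖ξ‖ : ℂ) * g₀ ξ) 2 volume < ⊤ →
        eLpNorm g₁ 2 volume < ⊤ →
        (eLpNorm (fun ξ => (‖ξ‖ : ℂ) *
              (E0 (nuOf μ) ‖ξ‖ t t₀ * g₀ ξ + E1 (nuOf μ) ‖ξ‖ t t₀ * g₁ ξ)) 2 volume ≤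
            ENNReal.ofReal C * (eLpNorm g₀ 2 volume +
              eLpNorm (fun ξ => (‖ξ‖ : ℂ) * g₀ ξ) 2 volume + eLpNorm g₁ 2 volume)) ∧
        (eLpNorm (fun ξ =>
              E0dot (nuOf μ) ‖ξ‖ t t₀ * g₀ ξ + E1dot (nuOf μ) ‖ξ‖ t t₀ * g₁ ξ) 2 volume ≤
            ENNReal.ofReal C * (eLpNorm g₀ 2 volume +
              eLpNorm (fun ξ => (‖ξ‖ : ℂ) * g₀ ξ) 2 volume + eLpNorm g₁ 2 volume)) ∧
        (eLpNorm (fun ξ =>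
              E0 (nuOf μ) ‖ξ‖ t t₀ * g₀ ξ + E1 (nuOf μ) ‖ξ‖ t t₀ * g₁ ξ) 2 volume ≤
            ENNReal.ofReal
                (C * (1 + t) ^ (1 / 2 + (nuOf μ).re) * (1 + t₀) ^ (1 / 2 - (nuOf μ).re)) *
              (eLpNorm g₀ 2 volume + eLpNorm g₁ 2 volume)) := by
  obtain ⟨C, hC, hCb⟩ := exists_norm_le_rpow hμ'
  have hmax : 0 < max C (1 + μ) := lt_max_of_lt_left hC
  refine ⟨max C (1 + μ), hmax, fun t t₀ ht₀ ht g₀ g₁ hg₀ hg₁ _ _ _ => ?_⟩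
  have h1 : 0 < 1 + t := by linarith
  have h10 : 0 < 1 + t₀ := by linarith
  have hm₀ : AEStronglyMeasurable (fun ξ => ‖g₀ ξ‖) volume := hg₀.norm.aestronglyMeasurable
  have hm₁ : AEStronglyMeasurable (fun ξ => ‖g₁ ξ‖) volume := hg₁.norm.aestronglyMeasurable
  have hm₂ : AEStronglyMeasurable (fun ξ => ‖(‖ξ‖ : ℂ) * g₀ ξ‖) volume :=
    ((Complex.measurable_ofReal.comp measurable_norm).mul hg₀).norm.aestronglyMeasurable
  have hsum₃ : eLpNorm (fun ξ => ‖g₀ ξ‖ + ‖(‖ξ‖ : ℂ) * g₀ ξ‖ + ‖g₁ ξ‖) 2 volume ≤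
      eLpNorm g₀ 2 volume + eLpNorm (fun ξ => (‖ξ‖ : ℂ) * g₀ ξ) 2 volume +
        eLpNorm g₁ 2 volume := by
    rw [← eLpNorm_norm g₀, ← eLpNorm_norm g₁, ← eLpNorm_norm fun ξ => (‖ξ‖ : ℂ) * g₀ ξ]
    refine (eLpNorm_add_le (hm₀.add hm₂) hm₁ one_le_two).trans ?_
    gcongr
    exact eLpNorm_add_le hm₀ hm₂ one_le_two
  have hsum₂ : eLpNorm (fun ξ => ‖g₀ ξ‖ + ‖g₁ ξ‖) 2 volume ≤
      eLpNorm g₀ 2 volume + eLpNorm g₁ 2 volume := by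
    rw [← eLpNorm_norm g₀, ← eLpNorm_norm g₁]
    exact eLpNorm_add_le hm₀ hm₁ one_le_two
  have hlin : ∀ ξ : EuclideanSpace ℝ (Fin d), ‖(‖ξ‖ : ℂ) * g₀ ξ‖ = ‖ξ‖ * ‖g₀ ξ‖ := fun ξ => by
    rw [norm_mul, Complex.norm_real, norm_norm]
  refine ⟨(eLpNorm_le_mul_eLpNorm_of_ae_le_mul (Filter.Eventually.of_forall fun ξ => ?_) 2).trans
      (mul_le_mul_right hsum₃ _),
    (eLpNorm_le_mul_eLpNorm_of_ae_le_mul (Filter.Eventually.of_forall fun ξ => ?_) 2).trans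
      (mul_le_mul_right hsum₃ _),
    (eLpNorm_le_mul_eLpNorm_of_ae_le_mul (Filter.Eventually.of_forall fun ξ => ?_) 2).trans
      (mul_le_mul_right hsum₂ _)⟩
  all_goals
    obtain ⟨y, v, hs, hy, hv, he⟩ := exists_isKGSolution_propagator hμ.le (norm_nonneg ξ)
      (show -1 < t₀ by linarith) (g₀ ξ) (g₁ ξ)
    obtain ⟨hyt, hvt⟩ := he t (by linarith)
    obtain ⟨ha, hb⟩ := hs.mul_norm_le_and_norm_le hμ.le (norm_nonneg ξ) ht₀ ht
  · rw [hyt, norm_mul, Complex.norm_real, norm_norm, hlin, Real.norm_of_nonneg (by positivity)]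
    refine ha.trans ?_
    gcongr
    exact le_max_right _ _
  · rw [hvt, hlin, Real.norm_of_nonneg (by positivity)]
    refine hb.trans ?_
    gcongr
    exact le_max_right _ _
  · rw [hyt, Real.norm_of_nonneg (by positivity)]
    refine (hCb _ _ _ hs t t₀ ht₀ ht).trans ?_
    gcongr
    exact le_max_left _ _

end
end

section
/- (L² growth estimate in the case μ = 1/4, Fourier formulation.) Let μ = 1/4 (so ν = 0) and let d ≥ 1. Then there exists C > 0, independent of t, t₀ and of the data, such that for all t ≥ t₀ ≥ 0 and all measurable g₀, g₁ : ℝ^d → ℂ with ‖g₀‖_{L²} + ‖g₁‖_{L²} < ∞, one has ‖ E_0(t,t₀,·) g₀ + E_1(t,t₀,·) g₁ ‖_{L²} ≤ C (1+t)^{1/2} (1+t₀)^{1/2} (1 + log((1+t)/(1+t₀))) (‖g₀‖_{L²} + ‖g₁‖_{L²}). -/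
open MeasureTheory Real Set

noncomputable section

/-- `u` solves Bessel's equation of order zero on `(0, ∞)`, written as a first-order system with
`p = x · du/dx`. -/
structure IsBesselPair {E : Type*} [NormedAddCommGroup E] [NormedSpace ℝ E] (u p : ℝ → E) :
    Prop where
  hasDerivAt_fst : ∀ x : ℝ, 0 < x → HasDerivAt u (x⁻¹ • p x) x
  hasDerivAt_snd : ∀ x : ℝ, 0 < x → HasDerivAt p (-(x • u x)) x

namespace IsBesselPair

theorem clm_comp {E F : Type*} [NormedAddCommGroup E] [NormedSpace ℝ E]
    [NormedAddCommGroup F] [NormedSpace ℝ F] {u p : ℝ → E} (h : IsBesselPair u p)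
    (L : E →L[ℝ] F) : IsBesselPair (fun x => L (u x)) (fun x => L (p x)) where
  hasDerivAt_fst x hx :=
    (L.hasFDerivAt.comp_hasDerivAt x (h.hasDerivAt_fst x hx)).congr_deriv (by simp)
  hasDerivAt_snd x hx :=
    (L.hasFDerivAt.comp_hasDerivAt x (h.hasDerivAt_snd x hx)).congr_deriv (by simp)

theorem linearCombination {u p v q : ℝ → ℂ} (h : IsBesselPair u p) (h' : IsBesselPair v q)
    (a b : ℂ) :
    IsBesselPair (fun x => a * u x + b * v x) (fun x => a * p x + b * q x) where
  hasDerivAt_fst x hx := by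
    refine (((h.hasDerivAt_fst x hx).const_mul a).add
      ((h'.hasDerivAt_fst x hx).const_mul b)).congr_deriv ?_
    simp only [Complex.real_smul]
    ring
  hasDerivAt_snd x hx := by
    refine (((h.hasDerivAt_snd x hx).const_mul a).add
      ((h'.hasDerivAt_snd x hx).const_mul b)).congr_deriv ?_
    simp only [Complex.real_smul]
    ring

/-- The energy `u² + (p/x)²` does not increase. -/
theorem energy_le {u p : ℝ → ℝ} (h : IsBesselPair u p) {a b : ℝ} (ha : 0 < a) (hab : a ≤ b) :
    u b ^ 2 + (p b / b) ^ 2 ≤ u a ^ 2 + (p a / a) ^ 2 := by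
  have hd : ∀ x, 0 < x →
      HasDerivAt (fun x => u x ^ 2 + (p x / x) ^ 2) (-(2 * p x ^ 2 / x ^ 3)) x := by
    intro x hx
    have hquot : HasDerivAt (fun x => p x / x) (-u x - p x / x ^ 2) x :=
      ((h.hasDerivAt_snd x hx).div (hasDerivAt_id' x) hx.ne').congr_deriv (by
        rw [smul_eq_mul]
        field_simp)
    refine (((h.hasDerivAt_fst x hx).pow 2).add (hquot.pow 2)).congr_deriv ?_
    simp only [smul_eq_mul, Nat.reduceSub, pow_one]
    field_simp
    ring
  refine antitoneOn_of_deriv_nonpos (convex_Ici a)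
    (fun x hx => (hd x (ha.trans_le hx)).continuousAt.continuousWithinAt)
    (fun x hx => ?_) (fun x hx => ?_) self_mem_Ici hab hab
  · rw [interior_Ici] at hx
    exact (hd x (ha.trans hx)).differentiableAt.differentiableWithinAt
  · rw [interior_Ici] at hx
    have hx0 : 0 < x := ha.trans hx
    rw [(hd x hx0).deriv, neg_nonpos]
    positivity

theorem abs_le_of_snd_eq_zero {u p : ℝ → ℝ} (h : IsBesselPair u p) {a b : ℝ} (ha : 0 < a)
    (hab : a ≤ b) (hp : p a = 0) : |u b| ≤ |u a| := by
  have := h.energy_le ha hab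
  rw [hp, zero_div] at this
  apply sq_le_sq.mp
  nlinarith [sq_nonneg (p b / b)]

/-- As long as `p ≥ 0`, a solution vanishing at `a` is nonnegative and grows at most
logarithmically. -/
theorem le_log_of_snd_nonneg {u p : ℝ → ℝ} (h : IsBesselPair u p) {a b : ℝ} (ha : 0 < a)
    (hab : a ≤ b) (hu : u a = 0) (hp : ∀ x ∈ Ico a b, 0 ≤ p x) :
    0 ≤ u b ∧ u b ≤ p a * Real.log (b / a) := by
  have hpos : ∀ {x}, x ∈ Icc a b → 0 < x := fun hx => ha.trans_le hx.1
  have hcu : ContinuousOn u (Icc a b) := fun x hx =>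
    (h.hasDerivAt_fst x (hpos hx)).continuousAt.continuousWithinAt
  have hcp : ContinuousOn p (Icc a b) := fun x hx =>
    (h.hasDerivAt_snd x (hpos hx)).continuousAt.continuousWithinAt
  have hu0 : ∀ x ∈ Icc a b, 0 ≤ u x := by
    refine image_le_of_deriv_right_le_deriv_boundary (f := fun _ => 0) (f' := fun _ => 0)
      continuousOn_const (fun x _ => hasDerivWithinAt_const _ _ _) hu.ge hcu
      (fun x hx => (h.hasDerivAt_fst x (hpos (Ico_subset_Icc_self hx))).hasDerivWithinAt)
      (fun x hx => ?_)
    have := hpos (Ico_subset_Icc_self hx)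
    have := hp x hx
    simp only [smul_eq_mul]
    positivity
  have hp1 : ∀ x ∈ Icc a b, p x ≤ p a := by
    refine image_le_of_deriv_right_le_deriv_boundary hcp
      (fun x hx => (h.hasDerivAt_snd x (hpos (Ico_subset_Icc_self hx))).hasDerivWithinAt) le_rfl
      continuousOn_const (fun x _ => hasDerivWithinAt_const _ _ (p a)) (fun x hx => ?_)
    have := hpos (Ico_subset_Icc_self hx)
    have := hu0 x (Ico_subset_Icc_self hx)
    simp only [smul_eq_mul, neg_nonpos]
    positivity
  have hlog : ∀ x, 0 < x → HasDerivAt (fun x => p a * Real.log (x / a)) (p a * x⁻¹) x := by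
    intro x hx
    refine ((((hasDerivAt_id x).div_const a).log
      (by simp [hx.ne', ha.ne'])).const_mul (p a)).congr_deriv ?_
    simp only [id]
    field_simp
  refine ⟨hu0 b (right_mem_Icc.2 hab), ?_⟩
  refine image_le_of_deriv_right_le_deriv_boundary
    (B := fun x => p a * Real.log (x / a)) hcu
    (fun x hx => (h.hasDerivAt_fst x (hpos (Ico_subset_Icc_self hx))).hasDerivWithinAt)
    (by simp [hu, ha.ne'])
    (fun x hx => (hlog x (hpos hx)).continuousAt.continuousWithinAt)
    (fun x hx => (hlog x (hpos (Ico_subset_Icc_self hx))).hasDerivWithinAt)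
    (fun x hx => ?_) (right_mem_Icc.2 hab)
  have := hpos (Ico_subset_Icc_self hx)
  have := hp1 x (Ico_subset_Icc_self hx)
  rw [smul_eq_mul, mul_comm]
  gcongr

/-- A solution vanishing at `a` grows at most logarithmically: up to the first zero of `p` this
is `le_log_of_snd_nonneg`, afterwards the energy takes over. -/
theorem abs_le_log_of_fst_eq_zero {u p : ℝ → ℝ} (h : IsBesselPair u p) {a b : ℝ} (ha : 0 < a)
    (hab : a ≤ b) (hu : u a = 0) (hp : 0 ≤ p a) : |u b| ≤ p a * Real.log (b / a) := by
  by_cases hall : ∀ x ∈ Ico a b, 0 ≤ p x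
  · obtain ⟨h0, h1⟩ := h.le_log_of_snd_nonneg ha hab hu hall
    rwa [abs_of_nonneg h0]
  push Not at hall
  obtain ⟨y, hy, hpy⟩ := hall
  have hcp : ContinuousOn p (Icc a b) := fun x hx =>
    (h.hasDerivAt_snd x (ha.trans_le hx.1)).continuousAt.continuousWithinAt
  have hclosed : IsClosed (Icc a b ∩ p ⁻¹' Iic 0) :=
    hcp.preimage_isClosed_of_isClosed isClosed_Icc isClosed_Iic
  obtain ⟨c, ⟨hc, hpc⟩, hmin⟩ := (isCompact_Icc.of_isClosed_subset hclosed
    inter_subset_left).exists_isLeast ⟨y, Ico_subset_Icc_self hy, hpy.le⟩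
  have hpos : ∀ x ∈ Ico a c, 0 ≤ p x := by
    intro x hx
    by_contra! hlt
    exact absurd (hmin ⟨⟨hx.1, hx.2.le.trans hc.2⟩, hlt.le⟩) (not_le.2 hx.2)
  have hpc0 : p c = 0 := by
    obtain ⟨z, hz, hpz⟩ := intermediate_value_Icc' hc.1 (hcp.mono (Icc_subset_Icc_right hc.2))
      ⟨hpc, hp⟩
    have := hmin ⟨⟨hz.1, hz.2.trans hc.2⟩, hpz.le⟩
    rwa [← le_antisymm hz.2 this]
  obtain ⟨h0, h1⟩ := h.le_log_of_snd_nonneg ha hc.1 hu hpos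
  have hc0 : 0 < c := ha.trans_le hc.1
  calc |u b| ≤ |u c| := h.abs_le_of_snd_eq_zero hc0 hc.2 hpc0
    _ = u c := abs_of_nonneg h0
    _ ≤ p a * Real.log (c / a) := h1
    _ ≤ p a * Real.log (b / a) := by
      gcongr
      exact hc.2

theorem norm_le_one {u p : ℝ → ℂ} (h : IsBesselPair u p) {a b : ℝ} (ha : 0 < a)
    (hab : a ≤ b) (hu : u a = 1) (hp : p a = 0) : ‖u b‖ ≤ 1 := by
  have hre := (h.clm_comp Complex.reCLM).abs_le_of_snd_eq_zero ha hab (by simp [hp])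
  have him := (h.clm_comp Complex.imCLM).abs_le_of_snd_eq_zero ha hab (by simp [hp])
  simp only [Complex.reCLM_apply, Complex.imCLM_apply, hu, Complex.one_re, Complex.one_im,
    abs_one, abs_zero] at hre him
  linarith [Complex.norm_le_abs_re_add_abs_im (u b)]

theorem norm_le_log {u p : ℝ → ℂ} (h : IsBesselPair u p) {a b : ℝ} (ha : 0 < a)
    (hab : a ≤ b) (hu : u a = 0) (hp : p a = 1) : ‖u b‖ ≤ Real.log (b / a) := by
  have hre := (h.clm_comp Complex.reCLM).abs_le_log_of_fst_eq_zero ha hab (by simp [hu])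
    (by simp [hp])
  have him := (h.clm_comp Complex.imCLM).abs_le_of_snd_eq_zero ha hab (by simp [hp])
  simp only [Complex.reCLM_apply, Complex.imCLM_apply, hu, hp, Complex.one_re, Complex.zero_im,
    one_mul, abs_zero] at hre him
  linarith [Complex.norm_le_abs_re_add_abs_im (u b)]

end IsBesselPair

/-- The sum of the power series with coefficients `a`. -/
def powSum (a : ℕ → ℂ) (z : ℂ) : ℂ := ∑' k, a k * z ^ k

/-- The coefficients of `z d/dz` applied to the power series with coefficients `a`. -/
def eulerCoeff (a : ℕ → ℂ) (k : ℕ) : ℂ := k * a k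

/-- The power series with coefficients `a` converges absolutely everywhere. -/
def IsEntireCoeff (a : ℕ → ℂ) : Prop := ∀ R : ℝ, 0 ≤ R → Summable fun k => ‖a k‖ * R ^ k

theorem natCast_le_two_pow (k : ℕ) : (k : ℝ) ≤ 2 ^ k := by
  exact_mod_cast Nat.lt_two_pow_self.le

namespace IsEntireCoeff

theorem of_norm_le {a : ℕ → ℂ} (h : ∀ k, ‖a k‖ ≤ 1 / (k.factorial : ℝ)) : IsEntireCoeff a := by
  intro R hR
  refine Summable.of_nonneg_of_le (fun k => by positivity) (fun k => ?_)
    (Real.summable_pow_div_factorial R)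
  calc ‖a k‖ * R ^ k ≤ 1 / (k.factorial : ℝ) * R ^ k := by gcongr; exact h k
    _ = R ^ k / k.factorial := by ring

theorem eulerCoeff {a : ℕ → ℂ} (h : IsEntireCoeff a) : IsEntireCoeff (eulerCoeff a) := by
  intro R hR
  refine Summable.of_nonneg_of_le (fun k => by positivity) (fun k => ?_) (h (2 * R) (by positivity))
  rw [_root_.eulerCoeff, norm_mul, Complex.norm_natCast, mul_pow]
  calc (k : ℝ) * ‖a k‖ * R ^ k ≤ 2 ^ k * ‖a k‖ * R ^ k := by
        gcongr; exact natCast_le_two_pow k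
    _ = ‖a k‖ * (2 ^ k * R ^ k) := by ring

theorem summable {a : ℕ → ℂ} (h : IsEntireCoeff a) (z : ℂ) : Summable fun k => a k * z ^ k := by
  refine Summable.of_norm ?_
  simpa using h ‖z‖ (norm_nonneg z)

theorem hasDerivAt_powSum {a : ℕ → ℂ} (h : IsEntireCoeff a) {z : ℂ} (hz : z ≠ 0) :
    HasDerivAt (powSum a) (powSum (_root_.eulerCoeff a) z / z) z := by
  have hR : (1 : ℝ) ≤ ‖z‖ + 1 := by linarith [norm_nonneg z]
  have hzR : z ∈ Metric.ball (0 : ℂ) (‖z‖ + 1) := by simp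
  have key := hasDerivAt_tsum_of_isPreconnected (g := fun n y => a n * y ^ n)
    (g' := fun n y => a n * (n * y ^ (n - 1))) (h (2 * (‖z‖ + 1)) (by positivity))
    Metric.isOpen_ball (convex_ball (0 : ℂ) (‖z‖ + 1)).isPreconnected
    (fun n y _ => (hasDerivAt_pow n y).const_mul (a n)) (fun n y hy => ?_) hzR (h.summable z) hzR
  · refine key.congr_deriv (Eq.symm ?_)
    rw [powSum, div_eq_mul_inv, ← tsum_mul_right]
    refine tsum_congr fun n => ?_
    rcases n with _ | n
    · simp [_root_.eulerCoeff]
    · rw [_root_.eulerCoeff, Nat.add_sub_cancel, pow_succ]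
      field_simp
  · rw [mem_ball_zero_iff] at hy
    rw [norm_mul, norm_mul, norm_pow, Complex.norm_natCast, mul_pow]
    gcongr
    · exact natCast_le_two_pow n
    · calc ‖y‖ ^ (n - 1) ≤ (‖z‖ + 1) ^ (n - 1) := by gcongr
        _ ≤ (‖z‖ + 1) ^ n := pow_le_pow_right₀ hR (Nat.sub_le n 1)

theorem hasDerivAt_powSum_sq {a : ℕ → ℂ} (h : IsEntireCoeff a) {x : ℝ} (hx : x ≠ 0) :
    HasDerivAt (fun y : ℝ => powSum a ((y / 2 : ℂ) ^ 2))
      (2 / x * powSum (_root_.eulerCoeff a) ((x / 2 : ℂ) ^ 2)) x := by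
  have hx' : (x : ℂ) ≠ 0 := by exact_mod_cast hx
  have h1 : HasDerivAt (fun y : ℂ => (y / 2) ^ 2) (x / 2 : ℂ) (x : ℂ) := by
    refine (((hasDerivAt_id (x : ℂ)).div_const 2).pow 2).congr_deriv ?_
    simp only [id]
    ring
  refine ((h.hasDerivAt_powSum (z := (x / 2 : ℂ) ^ 2) (by simpa using hx)).comp (x : ℂ)
    h1).comp_ofReal.congr_deriv ?_
  field_simp

theorem powSum_eq_mul {c e : ℕ → ℂ} (h : IsEntireCoeff c) (h0 : c 0 = 0)
    (hs : ∀ k, c (k + 1) = e k) (z : ℂ) : powSum c z = z * powSum e z := by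
  rw [powSum, (h.summable z).tsum_eq_zero_add, powSum, ← tsum_mul_left]
  simp only [h0, hs, zero_mul, zero_add]
  exact tsum_congr fun k => by ring

end IsEntireCoeff

/-- The coefficients of `J₀(τ)` as a power series in `(τ/2)²`. -/
def besselJ0Coeff (k : ℕ) : ℂ := (-1) ^ k / (k.factorial : ℂ) ^ 2

/-- The coefficients of the non-logarithmic part of `(π/2) Y₀(τ)` as a power series in
`(τ/2)²`. -/
def besselY0Coeff (k : ℕ) : ℂ := (-1) ^ (k + 1) * ((harmonic k : ℚ) : ℂ) / (k.factorial : ℂ) ^ 2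

theorem isEntireCoeff_besselJ0Coeff : IsEntireCoeff besselJ0Coeff := by
  refine .of_norm_le fun k => ?_
  have h1 : (1 : ℝ) ≤ k.factorial := by exact_mod_cast Nat.factorial_pos k
  simp only [besselJ0Coeff, norm_div, norm_pow, norm_neg, norm_one, one_pow, Complex.norm_natCast]
  gcongr
  nlinarith

theorem harmonic_le_natCast (k : ℕ) : harmonic k ≤ k := by
  induction k with
  | zero => simp
  | succ k ih =>
    rw [harmonic_succ]
    have : ((k + 1 : ℕ) : ℚ)⁻¹ ≤ 1 := inv_le_one_of_one_le₀ (by exact_mod_cast Nat.le_add_left 1 k)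
    push_cast at this ⊢
    linarith

theorem harmonic_nonneg (k : ℕ) : 0 ≤ harmonic k :=
  Finset.sum_nonneg fun _ _ => by positivity

theorem isEntireCoeff_besselY0Coeff : IsEntireCoeff besselY0Coeff := by
  refine .of_norm_le fun k => ?_
  have h1 : (0 : ℝ) < k.factorial := by exact_mod_cast Nat.factorial_pos k
  have h2 : ‖((harmonic k : ℚ) : ℂ)‖ ≤ k.factorial := by
    rw [← Complex.ofReal_ratCast, Complex.norm_real, Real.norm_eq_abs,
      abs_of_nonneg (by exact_mod_cast harmonic_nonneg k)]
    exact_mod_cast (harmonic_le_natCast k).trans (by exact_mod_cast Nat.self_le_factorial k)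
  simp only [besselY0Coeff, norm_div, norm_mul, norm_pow, norm_neg, norm_one, one_pow, one_mul,
    Complex.norm_natCast]
  rw [div_le_div_iff₀ (by positivity) h1]
  nlinarith

theorem powSum_eulerCoeff_besselJ0Coeff (z : ℂ) :
    powSum (eulerCoeff (eulerCoeff besselJ0Coeff)) z = -(z * powSum besselJ0Coeff z) := by
  rw [isEntireCoeff_besselJ0Coeff.eulerCoeff.eulerCoeff.powSum_eq_mul
    (e := fun k => -besselJ0Coeff k) (by simp [eulerCoeff]) (fun k => ?_)]
  · simp [powSum, tsum_neg]
  · have := Nat.cast_ne_zero (R := ℂ).2 k.factorial_ne_zero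
    have : (k : ℂ) + 1 ≠ 0 := by exact_mod_cast k.succ_ne_zero
    simp only [eulerCoeff, besselJ0Coeff, Nat.factorial_succ]
    push_cast
    field_simp
    ring

theorem powSum_eulerCoeff_besselY0Coeff (z : ℂ) :
    powSum (eulerCoeff (eulerCoeff besselY0Coeff)) z =
      -(z * powSum besselY0Coeff z) - powSum (eulerCoeff besselJ0Coeff) z := by
  have hY := isEntireCoeff_besselY0Coeff.eulerCoeff.eulerCoeff
  have hJ := isEntireCoeff_besselJ0Coeff.eulerCoeff
  have hadd : IsEntireCoeff
      fun k => eulerCoeff (eulerCoeff besselY0Coeff) k + eulerCoeff besselJ0Coeff k := by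
    intro R hR
    refine Summable.of_nonneg_of_le (fun k => by positivity) (fun k => ?_) ((hY R hR).add (hJ R hR))
    rw [← add_mul]
    gcongr
    exact norm_add_le _ _
  have key := hadd.powSum_eq_mul (e := fun k => -besselY0Coeff k) (by simp [eulerCoeff])
    (fun k => ?_) z
  · have hneg : powSum (fun k => -besselY0Coeff k) z = -powSum besselY0Coeff z := by
      simp [powSum, tsum_neg]
    rw [hneg] at key
    simp only [powSum, add_mul] at key ⊢
    rw [(hY.summable z).tsum_add (hJ.summable z)] at key
    linear_combination key
  · have := Nat.cast_ne_zero (R := ℂ).2 k.factorial_ne_zero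
    have : (k : ℂ) + 1 ≠ 0 := by exact_mod_cast k.succ_ne_zero
    simp only [eulerCoeff, besselJ0Coeff, besselY0Coeff, Nat.factorial_succ, harmonic_succ]
    push_cast
    field_simp
    ring

theorem besselJ_zero_eq (τ : ℝ) :
    besselJ 0 τ = powSum besselJ0Coeff ((τ / 2 : ℂ) ^ 2) := by
  refine tsum_congr fun k => ?_
  have h1 : (0 : ℂ) + 2 * (k : ℂ) = ((2 * k : ℕ) : ℂ) := by push_cast; ring
  rw [h1, Complex.cpow_natCast, zero_add, Complex.Gamma_nat_eq_factorial, pow_mul, besselJ0Coeff]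
  ring

theorem besselY0_eq (τ : ℝ) :
    besselY0 τ = 2 / (π : ℂ) * ((Complex.log (τ / 2 : ℂ) + Real.eulerMascheroniConstant) *
      powSum besselJ0Coeff ((τ / 2 : ℂ) ^ 2) + powSum besselY0Coeff ((τ / 2 : ℂ) ^ 2)) := by
  have h : powSum besselY0Coeff ((τ / 2 : ℂ) ^ 2) =
      ∑' k : ℕ, ((-1 : ℂ) ^ ((k + 1) + 1) * ((harmonic (k + 1) : ℚ) : ℂ) /
          ((Nat.factorial (k + 1) : ℂ)) ^ 2) * ((τ : ℂ) / 2) ^ (2 * (k + 1)) := by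
    rw [powSum, (isEntireCoeff_besselY0Coeff.summable _).tsum_eq_zero_add]
    simp only [besselY0Coeff, harmonic_zero, ← pow_mul]
    simp
  rw [besselY0, besselJ_zero_eq, h]
  ring

theorem exists_isBesselPair_besselJ : ∃ p, IsBesselPair (besselJ 0) p := by
  refine ⟨fun x => 2 * powSum (eulerCoeff besselJ0Coeff) ((x / 2 : ℂ) ^ 2), fun x hx => ?_,
    fun x hx => ?_⟩
  · refine ((isEntireCoeff_besselJ0Coeff.hasDerivAt_powSum_sq hx.ne').congr_of_eventuallyEq
      (.of_forall besselJ_zero_eq)).congr_deriv ?_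
    rw [Complex.real_smul]
    push_cast
    ring
  · refine ((isEntireCoeff_besselJ0Coeff.eulerCoeff.hasDerivAt_powSum_sq
      hx.ne').const_mul 2).congr_deriv ?_
    have : (x : ℂ) ≠ 0 := by exact_mod_cast hx.ne'
    rw [powSum_eulerCoeff_besselJ0Coeff, Complex.real_smul, besselJ_zero_eq]
    field_simp

theorem exists_isBesselPair_besselY0 : ∃ p, IsBesselPair besselY0 p := by
  have hlog : ∀ x : ℝ, 0 < x → HasDerivAt
      (fun y : ℝ => Complex.log (y / 2 : ℂ) + Real.eulerMascheroniConstant) (x : ℂ)⁻¹ x := by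
    intro x hx
    have hx' : (x : ℂ) ≠ 0 := by exact_mod_cast hx.ne'
    have hs : (x : ℂ) / 2 ∈ Complex.slitPlane := by
      left
      simpa using hx
    refine ((((hasDerivAt_id (x : ℂ)).div_const 2).clog hs).comp_ofReal.add_const _).congr_deriv ?_
    simp only [id]
    field_simp
  refine ⟨fun x => 2 / (π : ℂ) * (powSum besselJ0Coeff ((x / 2 : ℂ) ^ 2) +
    2 * ((Complex.log (x / 2 : ℂ) + Real.eulerMascheroniConstant) *
      powSum (eulerCoeff besselJ0Coeff) ((x / 2 : ℂ) ^ 2) +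
    powSum (eulerCoeff besselY0Coeff) ((x / 2 : ℂ) ^ 2))), fun x hx => ?_, fun x hx => ?_⟩
  · refine (((((hlog x hx).mul (isEntireCoeff_besselJ0Coeff.hasDerivAt_powSum_sq hx.ne')).add
      (isEntireCoeff_besselY0Coeff.hasDerivAt_powSum_sq hx.ne')).const_mul
        (2 / (π : ℂ))).congr_of_eventuallyEq
      (.of_forall besselY0_eq)).congr_deriv ?_
    rw [Complex.real_smul]
    push_cast
    ring
  · refine (((isEntireCoeff_besselJ0Coeff.hasDerivAt_powSum_sq hx.ne').add
      ((((hlog x hx).mul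
        (isEntireCoeff_besselJ0Coeff.eulerCoeff.hasDerivAt_powSum_sq hx.ne')).add
      (isEntireCoeff_besselY0Coeff.eulerCoeff.hasDerivAt_powSum_sq hx.ne')).const_mul
        2)).const_mul (2 / (π : ℂ))).congr_deriv ?_
    have : (x : ℂ) ≠ 0 := by exact_mod_cast hx.ne'
    have : (π : ℂ) ≠ 0 := by exact_mod_cast Real.pi_ne_zero
    rw [powSum_eulerCoeff_besselJ0Coeff, powSum_eulerCoeff_besselY0Coeff, Complex.real_smul,
      besselY0_eq]
    field_simp
    ring

/-- The time derivative of `τ^{1/2} u(τ)`, `τ = (1+t) r`, for a solution `u` of Bessel's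
equation. -/
theorem IsBesselPair.deriv_sqrt_mul {u p : ℝ → ℂ} (h : IsBesselPair u p) {r t : ℝ} (hr : 0 < r)
    (ht : 0 ≤ t) :
    deriv (fun s : ℝ => (Real.sqrt ((1 + s) * r) : ℂ) * u ((1 + s) * r)) t =
      r / Real.sqrt ((1 + t) * r) * (u ((1 + t) * r) / 2 + p ((1 + t) * r)) := by
  have hτ : 0 < (1 + t) * r := by positivity
  have h1 : HasDerivAt (fun s : ℝ => (1 + s) * r) r t := by
    simpa using ((hasDerivAt_id t).const_add 1).mul_const r
  have h2 := ((h1.sqrt hτ.ne').ofReal_comp).mul ((h.hasDerivAt_fst _ hτ).scomp t h1)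
  refine h2.deriv.trans ?_
  obtain ⟨q, hq, hq'⟩ : ∃ q : ℝ, 0 < q ∧ (1 + t) * r = q ^ 2 :=
    ⟨√((1 + t) * r), Real.sqrt_pos.2 hτ, (Real.sq_sqrt hτ.le).symm⟩
  have hqc : (q : ℂ) ≠ 0 := by exact_mod_cast hq.ne'
  simp only [Function.comp_apply, Complex.real_smul, hq', Real.sqrt_sq hq.le]
  push_cast
  field_simp

theorem norm_E0Z_E1Z_le {r t t₀ : ℝ} (hr : 0 ≤ r) (ht₀ : 0 ≤ t₀) (ht : t₀ ≤ t) :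
    ‖E0Z r t t₀‖ ≤ √(1 + t) * √(1 + t₀) * (1 + Real.log ((1 + t) / (1 + t₀))) ∧
    ‖E1Z r t t₀‖ ≤ √(1 + t) * √(1 + t₀) * (1 + Real.log ((1 + t) / (1 + t₀))) := by
  have hlog : 0 ≤ Real.log ((1 + t) / (1 + t₀)) :=
    Real.log_nonneg ((one_le_div (by positivity)).2 (by linarith))
  have hK : 0 ≤ √(1 + t) * √(1 + t₀) * (1 + Real.log ((1 + t) / (1 + t₀))) := by positivity
  rcases hr.eq_or_lt with rfl | hr
  · simpa [E0Z, E1Z, ePlus, eMinusZ] using hK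
  obtain ⟨p, hJ⟩ := exists_isBesselPair_besselJ
  obtain ⟨q, hY⟩ := exists_isBesselPair_besselY0
  have hτ₀ : 0 < (1 + t₀) * r := by positivity
  have hτ : (1 + t₀) * r ≤ (1 + t) * r := by gcongr
  have hdiv : (1 + t) * r / ((1 + t₀) * r) = (1 + t) / (1 + t₀) := mul_div_mul_right _ _ hr.ne'
  have hdp := hJ.deriv_sqrt_mul hr ht₀
  have hdq := hY.deriv_sqrt_mul hr ht₀
  have hdp' : ePlusDot 0 r t₀ = _ := hdp
  have hdq' : eMinusZDot r t₀ = _ := hdq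
  simp only [E0Z, E1Z, hdp', hdq', ePlus, eMinusZ]
  have hsq : √((1 + t) * r) = √(1 + t) * √r := Real.sqrt_mul (by linarith) r
  have hsq₀ : √((1 + t₀) * r) = √(1 + t₀) * √r := Real.sqrt_mul (by linarith) r
  have hr2 : (r : ℂ) = (√r : ℂ) ^ 2 := by exact_mod_cast (Real.sq_sqrt hr.le).symm
  simp only [hsq, hsq₀]
  rw [hr2]
  have hr0 : (√r : ℂ) ≠ 0 := by exact_mod_cast (Real.sqrt_pos.2 hr).ne'
  have hs₀ : (√(1 + t₀) : ℂ) ≠ 0 := by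
    exact_mod_cast (Real.sqrt_pos.2 (by linarith : 0 < 1 + t₀)).ne'
  set τ := (1 + t) * r
  set τ₀ := (1 + t₀) * r
  set ω := besselJ 0 τ₀ * q τ₀ - p τ₀ * besselY0 τ₀ with hω
  have hden : ((√(1 + t₀) * √r : ℝ) : ℂ) * besselJ 0 τ₀ *
        ((√r : ℂ) ^ 2 / ((√(1 + t₀) * √r : ℝ) : ℂ) * (besselY0 τ₀ / 2 + q τ₀)) -
      (√r : ℂ) ^ 2 / ((√(1 + t₀) * √r : ℝ) : ℂ) * (besselJ 0 τ₀ / 2 + p τ₀) *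
        (((√(1 + t₀) * √r : ℝ) : ℂ) * besselY0 τ₀) = (√r : ℂ) ^ 2 * ω := by
    push_cast
    rw [hω]
    field_simp
    ring
  rw [hden]
  by_cases hω0 : ω = 0
  · simpa [hω0] using hK
  have hφ := (hJ.linearCombination hY (q τ₀ / ω) (-(p τ₀ / ω))).norm_le_one hτ₀ hτ
    (by field_simp; rw [hω]; ring) (by ring)
  have hψ := (hJ.linearCombination hY (-(besselY0 τ₀ / ω)) (besselJ 0 τ₀ / ω)).norm_le_log hτ₀ hτ
    (by ring) (by field_simp; rw [hω]; ring)
  rw [hdiv] at hψ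
  set φ := q τ₀ / ω * besselJ 0 τ + -(p τ₀ / ω) * besselY0 τ with hφ_def
  set ψ := -(besselY0 τ₀ / ω) * besselJ 0 τ + besselJ 0 τ₀ / ω * besselY0 τ with hψ_def
  have hs1 : 1 ≤ √(1 + t₀) := Real.one_le_sqrt.2 (by linarith)
  constructor
  · have : ‖φ - ψ / 2‖ ≤ 1 + Real.log ((1 + t) / (1 + t₀)) := by
      refine (norm_sub_le _ _).trans ?_
      rw [norm_div, Complex.norm_ofNat]
      linarith
    calc _ = ‖((√(1 + t) / √(1 + t₀) : ℝ) : ℂ) * (φ - ψ / 2)‖ := by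
          congr 1
          rw [hφ_def, hψ_def]
          push_cast
          field_simp
          ring
      _ = √(1 + t) / √(1 + t₀) * ‖φ - ψ / 2‖ := by
          rw [norm_mul, Complex.norm_real, Real.norm_of_nonneg (by positivity)]
      _ ≤ _ := by
          gcongr
          exact (div_le_self (by positivity) hs1).trans (le_mul_of_one_le_right (by positivity) hs1)
  · calc _ = ‖((√(1 + t) * √(1 + t₀) : ℝ) : ℂ) * ψ‖ := by
          congr 1
          rw [hψ_def]
          push_cast
          field_simp
          ring
      _ = √(1 + t) * √(1 + t₀) * ‖ψ‖ := by
          rw [norm_mul, Complex.norm_real, Real.norm_of_nonneg (by positivity)]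
      _ ≤ _ := by
          gcongr
          linarith

theorem eLpNorm_mul_add_mul_le {α : Type*} [MeasurableSpace α] {ν : Measure α}
    {a b f g : α → ℂ} {K : ℝ} (hK : 0 ≤ K) (ha : ∀ x, ‖a x‖ ≤ K) (hb : ∀ x, ‖b x‖ ≤ K)
    (hf : AEStronglyMeasurable f ν) (hg : AEStronglyMeasurable g ν) :
    eLpNorm (fun x => a x * f x + b x * g x) 2 ν ≤
      ENNReal.ofReal K * (eLpNorm f 2 ν + eLpNorm g 2 ν) := by
  calc eLpNorm (fun x => a x * f x + b x * g x) 2 ν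
      ≤ eLpNorm (K • ((fun x => ‖f x‖) + fun x => ‖g x‖)) 2 ν := by
        refine eLpNorm_mono_real fun x => (norm_add_le _ _).trans ?_
        simp only [norm_mul, Pi.smul_apply, Pi.add_apply, smul_eq_mul, mul_add]
        gcongr
        exacts [ha x, hb x]
    _ ≤ ENNReal.ofReal K * eLpNorm ((fun x => ‖f x‖) + fun x => ‖g x‖) 2 ν := by
        rw [← Real.enorm_of_nonneg hK]
        exact eLpNorm_const_smul_le
    _ ≤ ENNReal.ofReal K * (eLpNorm f 2 ν + eLpNorm g 2 ν) := by
        gcongr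
        refine (eLpNorm_add_le hf.norm hg.norm (by norm_num)).trans ?_
        rw [eLpNorm_norm, eLpNorm_norm]

/-- `L²` growth estimate in the case `μ = 1/4` (Fourier formulation). -/
theorem stmt14 (d : ℕ) (hd : 1 ≤ d) :
    ∃ C > (0 : ℝ), ∀ t t₀ : ℝ, 0 ≤ t₀ → t₀ ≤ t →
      ∀ g₀ g₁ : EuclideanSpace ℝ (Fin d) → ℂ, Measurable g₀ → Measurable g₁ →
        eLpNorm g₀ 2 volume < ⊤ → eLpNorm g₁ 2 volume < ⊤ →
        eLpNorm (fun ξ => E0Z ‖ξ‖ t t₀ * g₀ ξ + E1Z ‖ξ‖ t t₀ * g₁ ξ) 2 volume ≤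
          ENNReal.ofReal
              (C * (1 + t) ^ ((1 : ℝ) / 2) * (1 + t₀) ^ ((1 : ℝ) / 2) *
                (1 + Real.log ((1 + t) / (1 + t₀)))) *
            (eLpNorm g₀ 2 volume + eLpNorm g₁ 2 volume) := by
  refine ⟨1, one_pos, fun t t₀ ht₀ ht g₀ g₁ hg₀ hg₁ _ _ => ?_⟩
  have hlog : 0 ≤ Real.log ((1 + t) / (1 + t₀)) :=
    Real.log_nonneg ((one_le_div (by positivity)).2 (by linarith))
  rw [one_mul, ← Real.sqrt_eq_rpow, ← Real.sqrt_eq_rpow]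
  exact eLpNorm_mul_add_mul_le (by positivity)
    (fun ξ => (norm_E0Z_E1Z_le (norm_nonneg ξ) ht₀ ht).1)
    (fun ξ => (norm_E0Z_E1Z_le (norm_nonneg ξ) ht₀ ht).2)
    hg₀.aestronglyMeasurable hg₁.aestronglyMeasurable

end
end
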